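/- arXiv:2010.13564 — 3 statements merged into one kernel-verified Lean document; each statement's English description precedes it below -/
import Mathlib

section
/- Let t < T be real numbers, let k ≥ 1 be an integer, and let f_1, …, f_k : [t,T] → ℝ be integrable. Then the sum over all permutations of the iterated simplex integrals equals the product of the single integrals: Σ_{σ ∈ S_k} ∫_t^T f_{σ(k)}(t_k) ∫_t^{t_k} ⋯ ∫_t^{t_2} f_{σ(1)}(t_1) dt_1 ⋯ dt_k = ∏_{l=1}^k ∫_t^T f_l(s) ds. -/
open MeasureTheory

/-- Iterated simplex integral with lower limit `a`: for a list `[g₁, …, gₙ]`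
(outermost integrand first),
`simplexIntegral a [g₁, …, gₙ] b = ∫_a^b g₁(s) · simplexIntegral a [g₂, …, gₙ] s ds`. -/
noncomputable def simplexIntegral (a : ℝ) : List (ℝ → ℝ) → ℝ → ℝ
  | [], _ => 1
  | f :: fs, b => ∫ s in a..b, f s * simplexIntegral a fs s

/-- The kernel `K(t₁,…,t_k) = ψ₁(t₁)⋯ψ_k(t_k)` for `t₁ < ⋯ < t_k`, and `0` otherwise. -/
noncomputable def kernelK {k : ℕ} (ψ : Fin k → ℝ → ℝ) (x : Fin k → ℝ) : ℝ :=
  if StrictMono x then ∏ l, ψ l (x l) else 0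

/-- The product measure on `[t,T]^k`. -/
noncomputable def boxMeasure (t T : ℝ) (k : ℕ) : Measure (Fin k → ℝ) :=
  Measure.pi fun _ => volume.restrict (Set.Icc t T)

open Set in
theorem AbsolutelyContinuousOnInterval.fun_prod {ι : Type*} {F : ι → ℝ → ℝ} {a b : ℝ}
    (s : Finset ι) (hF : ∀ i ∈ s, AbsolutelyContinuousOnInterval (F i) a b) :
    AbsolutelyContinuousOnInterval (fun x => ∏ i ∈ s, F i x) a b := by
  classical
  induction s using Finset.induction_on with
  | empty =>
    simpa using ((LipschitzWith.const (1 : ℝ)).lipschitzOnWith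
      (s := uIcc a b)).absolutelyContinuousOnInterval
  | insert i s hi ih =>
    simp only [Finset.prod_insert hi]
    exact (hF i (by simp)).fun_mul (ih fun j hj => hF j (by simp [hj]))

/-- The Leibniz rule for a nonempty finite product of primitives of integrable functions. -/
theorem Finset.prod_intervalIntegral_eq_sum {ι : Type*} [DecidableEq ι] {s : Finset ι}
    (hs : s.Nonempty) {f : ι → ℝ → ℝ} {a b : ℝ}
    (hf : ∀ i ∈ s, IntervalIntegrable (f i) volume a b) :
    ∏ i ∈ s, ∫ x in a..b, f i x =
      ∑ i ∈ s, ∫ x in a..b, f i x * ∏ j ∈ s.erase i, ∫ y in a..x, f j y := by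
  have hac : ∀ i ∈ s, AbsolutelyContinuousOnInterval (fun x => ∫ y in a..x, f i y) a b :=
    fun i hi => (hf i hi).absolutelyContinuousOnInterval_intervalIntegral (by simp)
  have hFTC := (AbsolutelyContinuousOnInterval.fun_prod s hac).integral_deriv_eq_sub
  obtain ⟨i₀, hi₀⟩ := hs
  rw [Finset.prod_eq_zero (f := fun i => ∫ y in a..a, f i y) hi₀ (by simp), sub_zero] at hFTC
  rw [← hFTC, ← intervalIntegral.integral_finsetSum]
  · refine intervalIntegral.integral_congr_ae ?_
    have h := (Filter.eventually_all_finset s (l := ae volume)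
      (p := fun i x => x ∈ Set.uIcc a b → ∀ c ∈ Set.uIcc a b,
        HasDerivAt (fun x => ∫ y in c..x, f i y) (f i x) x)).2
      fun i hi => (hf i hi).ae_hasDerivAt_integral
    filter_upwards [h] with x hx hxab
    have hd := HasDerivAt.fun_finsetProd fun i hi => hx i hi (Set.uIoc_subset_uIcc hxab) a
      Set.left_mem_uIcc
    rw [hd.deriv]
    exact Finset.sum_congr rfl fun i _ => by rw [smul_eq_mul, mul_comm]
  · intro i hi
    exact (hf i hi).mul_continuousOn <| continuousOn_finsetProd _ fun j hj =>
      (hac j (Finset.mem_of_mem_erase hj)).continuousOn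

open Set in
theorem continuousOn_simplexIntegral {a b : ℝ} (fs : List (ℝ → ℝ))
    (hfs : ∀ f ∈ fs, IntervalIntegrable f volume a b) :
    ContinuousOn (simplexIntegral a fs) (uIcc a b) := by
  induction fs with
  | nil => exact continuousOn_const
  | cons f fs ih =>
    exact intervalIntegral.continuousOn_primitive_interval'
      ((hfs f (by simp)).mul_continuousOn (ih fun g hg => hfs g (by simp [hg]))) left_mem_uIcc

theorem sum_perm_simplexIntegral_ofFn {a b : ℝ} {k : ℕ} (f : Fin k → ℝ → ℝ)
    (hf : ∀ l, IntervalIntegrable (f l) volume a b) :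
    ∑ σ : Equiv.Perm (Fin k), simplexIntegral a (List.ofFn fun l => f (σ l)) b =
      ∏ l, ∫ s in a..b, f l s := by
  induction k generalizing b with
  | zero => simp [simplexIntegral]
  | succ n ih =>
    rw [Finset.prod_intervalIntegral_eq_sum Finset.univ_nonempty fun i _ => hf i,
      ← Equiv.Perm.decomposeFin.symm.sum_comp, Fintype.sum_prod_type]
    refine Finset.sum_congr rfl fun p _ => ?_
    simp only [List.ofFn_succ, simplexIntegral, Equiv.Perm.decomposeFin_symm_apply_zero,
      Equiv.Perm.decomposeFin_symm_apply_succ]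
    rw [← intervalIntegral.integral_finsetSum]
    · refine intervalIntegral.integral_congr fun x hx => ?_
      rw [← Finset.mul_sum, ih (fun l => f (Equiv.swap 0 p l.succ))
        fun l => (hf _).mono_set (Set.uIcc_subset_uIcc_left hx)]
      congr 1
      refine Finset.prod_bij (fun l _ => Equiv.swap 0 p l.succ) ?_ ?_ ?_ fun _ _ => rfl
      · intro l _
        simp [Equiv.swap_apply_eq_iff]
      · intro l _ m _ h
        simpa using h
      · intro m hm
        obtain ⟨l, hl⟩ := Fin.exists_succ_eq.2 (show Equiv.swap 0 p m ≠ 0 by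
          simpa [Equiv.swap_apply_eq_iff] using hm)
        exact ⟨l, Finset.mem_univ _, by simp [hl]⟩
    · intro e _
      refine (hf p).mul_continuousOn (continuousOn_simplexIntegral _ ?_)
      simp only [List.forall_mem_ofFn_iff]
      exact fun l => hf _

theorem List.reverse_ofFn_eq {α : Type*} {n : ℕ} (g : Fin n → α) :
    (List.ofFn g).reverse = List.ofFn fun i => g i.rev := by
  refine List.ext_getElem (by simp) fun i h₁ h₂ => ?_
  simp only [List.getElem_reverse, List.getElem_ofFn, List.length_ofFn]
  congr 1
  ext
  simp [Fin.val_rev]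
  omega


theorem stmt_3 (t T : ℝ) (ht : t < T) (k : ℕ) (hk : 1 ≤ k)
    (f : Fin k → ℝ → ℝ)
    (hf : ∀ l, IntegrableOn (f l) (Set.Icc t T)) :
    ∑ σ : Equiv.Perm (Fin k),
        simplexIntegral t ((List.ofFn fun l => f (σ l)).reverse) T =
      ∏ l, ∫ s in t..T, f l s := by
  have hf' : ∀ l, IntervalIntegrable (f l) volume t T := fun l =>
    (intervalIntegrable_iff_integrableOn_Icc_of_le ht.le).2 (hf l)
  rw [← sum_perm_simplexIntegral_ofFn f hf',
    ← Equiv.sum_comp (Equiv.mulRight (Fin.revPerm : Equiv.Perm (Fin k)))]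
  refine Finset.sum_congr rfl fun σ _ => ?_
  rw [List.reverse_ofFn_eq]
  simp
end

section
/- Let t < T and let (φ_j)_{j≥0} be the normalized Legendre system on [t,T]. Define the double iterated integral coefficients C_{j_2 j_1} = ∫_t^T φ_{j_2}(s) ∫_t^{s} φ_{j_1}(τ) dτ ds. Then: C_{00} = (T−t)/2; for every j ≥ 1, C_{j, j−1} = (T−t)/(2√(4j²−1)) and C_{j−1, j} = −(T−t)/(2√(4j²−1)); and C_{j_2 j_1} = 0 for all other pairs (j_1, j_2), i.e. whenever |j_1 − j_2| ≠ 1 and (j_1, j_2) ≠ (0,0). -/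
open MeasureTheory

/-- The Legendre polynomial `P_n(x) = (1/(2^n n!)) dⁿ/dxⁿ (x²−1)ⁿ` (Rodrigues formula). -/
noncomputable def legendreP (n : ℕ) (x : ℝ) : ℝ :=
  (1 / (2 ^ n * (Nat.factorial n) : ℝ)) * iteratedDeriv n (fun y : ℝ => (y ^ 2 - 1) ^ n) x

/-- The normalized Legendre system on `[t,T]`:
`φ_j(x) = √((2j+1)/(T−t)) · P_j((2x − (T+t))/(T−t))`. -/
noncomputable def legendreSys (t T : ℝ) (j : ℕ) (x : ℝ) : ℝ :=
  Real.sqrt ((2 * (j : ℝ) + 1) / (T - t)) * legendreP j ((2 * x - (T + t)) / (T - t))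

/-- The double iterated integral coefficient `C_{j₂ j₁} = ∫_t^T φ_{j₂}(s) ∫_t^s φ_{j₁}(τ) dτ ds`. -/
noncomputable def doubleCoef (t T : ℝ) (j₂ j₁ : ℕ) : ℝ :=
  ∫ s in t..T, legendreSys t T j₂ s * ∫ τ in t..s, legendreSys t T j₁ τ

open Polynomial

/-- `(X² − 1)ⁿ`, whose `n`-th derivative is a multiple of the Legendre polynomial. -/
noncomputable def rodriguesBase (n : ℕ) : ℝ[X] := (X ^ 2 - 1) ^ n

/-- The antiderivative of `derivative^[n] (rodriguesBase n)` vanishing at `-1`. -/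
noncomputable def rodriguesPrimitive : ℕ → ℝ[X]
  | 0 => X + 1
  | n + 1 => derivative^[n] (rodriguesBase (n + 1))

namespace Polynomial

theorem integral_derivative_mul_eval (p q : ℝ[X]) (a b : ℝ) :
    ∫ x in a..b, (derivative p * q).eval x =
      (p * q).eval b - (p * q).eval a - ∫ x in a..b, (p * derivative q).eval x := by
  have h := intervalIntegral.integral_eq_sub_of_hasDerivAt (a := a) (b := b)
    (fun x _ => (p * q).hasDerivAt x) ((derivative (p * q)).continuous.intervalIntegrable _ _)
  simp only [derivative_mul, eval_add] at h
  rw [intervalIntegral.integral_add ((derivative p * q).continuous.intervalIntegrable _ _)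
    ((p * derivative q).continuous.intervalIntegrable _ _)] at h
  linarith

theorem iteratedDeriv_eval (p : ℝ[X]) (n : ℕ) :
    iteratedDeriv n (fun x => p.eval x) = fun x => (derivative^[n] p).eval x := by
  induction n with
  | zero => simp
  | succ n ih =>
    ext x
    rw [iteratedDeriv_succ, ih, Function.iterate_succ_apply', Polynomial.deriv]

end Polynomial

theorem legendreP_eq_eval (n : ℕ) (x : ℝ) :
    legendreP n x =
      (1 / (2 ^ n * n.factorial : ℝ)) * (derivative^[n] (rodriguesBase n)).eval x := by
  have h := congrFun (iteratedDeriv_eval (rodriguesBase n) n) x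
  simp only [rodriguesBase, eval_pow, eval_sub, eval_X, eval_one] at h
  rw [legendreP, h, rodriguesBase]

theorem eval_iterate_derivative_rodriguesBase {n k : ℕ} (hk : k < n) {x : ℝ} (hx : x ^ 2 = 1) :
    (derivative^[k] (rodriguesBase n)).eval x = 0 := by
  obtain ⟨r, hr⟩ := pow_sub_dvd_iterate_derivative_pow (X ^ 2 - 1 : ℝ[X]) n k
  rw [rodriguesBase, hr]
  simp [hx, Nat.sub_ne_zero_of_lt hk]

theorem iterate_derivative_rodriguesBase (n : ℕ) :
    derivative^[2 * n] (rodriguesBase n) = C ((2 * n).factorial : ℝ) := by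
  have hm : (X ^ 2 - 1 : ℝ[X]).Monic := by
    simpa using monic_X_pow_sub_C (1 : ℝ) two_ne_zero
  have hd : (X ^ 2 - 1 : ℝ[X]).natDegree = 2 := by
    simpa using natDegree_X_pow_sub_C (n := 2) (r := (1 : ℝ))
  have hn : (rodriguesBase n).natDegree = 2 * n := by
    rw [rodriguesBase, hm.natDegree_pow, hd, mul_comm]
  have hl : (rodriguesBase n).coeff (2 * n) = 1 := by
    rw [← hn]; exact hm.pow n
  ext m
  rw [coeff_iterate_derivative]
  rcases m with _ | m
  · simp [hl, Nat.descFactorial_self]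
  · rw [coeff_eq_zero_of_natDegree_lt (by omega), coeff_C_of_ne_zero (by omega), smul_zero]

theorem derivative_rodriguesPrimitive (n : ℕ) :
    derivative (rodriguesPrimitive n) = derivative^[n] (rodriguesBase n) := by
  cases n with
  | zero => simp [rodriguesPrimitive, rodriguesBase]
  | succ n => rw [rodriguesPrimitive, Function.iterate_succ_apply']

theorem rodriguesPrimitive_eval_neg_one (n : ℕ) : (rodriguesPrimitive n).eval (-1) = 0 := by
  cases n with
  | zero => simp [rodriguesPrimitive]
  | succ n => exact eval_iterate_derivative_rodriguesBase n.lt_succ_self (by norm_num)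

theorem rodriguesPrimitive_eval_one {n : ℕ} (hn : n ≠ 0) : (rodriguesPrimitive n).eval 1 = 0 := by
  cases n with
  | zero => exact absurd rfl hn
  | succ n => exact eval_iterate_derivative_rodriguesBase n.lt_succ_self (by norm_num)

theorem integral_iterate_derivative_rodriguesBase_mul {n k : ℕ} (hk : k ≤ n) (q : ℝ[X]) :
    ∫ x in (-1 : ℝ)..1, (derivative^[k] (rodriguesBase n) * q).eval x =
      (-1) ^ k * ∫ x in (-1 : ℝ)..1, (rodriguesBase n * derivative^[k] q).eval x := by
  induction k generalizing q with
  | zero => simp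
  | succ k ih =>
    rw [Function.iterate_succ_apply', integral_derivative_mul_eval, ih (by omega),
      ← Function.iterate_succ_apply, eval_mul, eval_mul,
      eval_iterate_derivative_rodriguesBase hk (by norm_num),
      eval_iterate_derivative_rodriguesBase hk (by norm_num)]
    ring

theorem integral_rodriguesBase (n : ℕ) :
    ∫ x in (-1 : ℝ)..1, (rodriguesBase n).eval x =
      (-1) ^ n * (2 ^ (2 * n + 1) * (n.factorial : ℝ) ^ 2 / ((2 * n + 1).factorial : ℝ)) := by
  induction n with
  | zero => simp [rodriguesBase]; norm_num
  | succ n ih =>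
    have h := integral_derivative_mul_eval X (rodriguesBase (n + 1)) (-1) 1
    have hd : X * derivative (rodriguesBase (n + 1)) =
        C (2 * (n + 1) : ℝ) * rodriguesBase (n + 1) + C (2 * (n + 1) : ℝ) * rodriguesBase n := by
      have hC : (C (2 * (n + 1) : ℝ) : ℝ[X]) = 2 * (n + 1) := by simp [map_ofNat C 2]
      rw [hC]
      simp only [rodriguesBase, derivative_pow]
      simp
      ring
    rw [hd] at h
    simp only [derivative_X, one_mul, eval_add, eval_C_mul] at h
    rw [intervalIntegral.integral_add
      (((rodriguesBase (n + 1)).continuous.intervalIntegrable _ _).const_mul _)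
      (((rodriguesBase n).continuous.intervalIntegrable _ _).const_mul _),
      intervalIntegral.integral_const_mul, intervalIntegral.integral_const_mul, ih] at h
    have e1 : (X * rodriguesBase (n + 1)).eval 1 = 0 := by simp [rodriguesBase]
    have e2 : (X * rodriguesBase (n + 1)).eval (-1) = 0 := by simp [rodriguesBase]
    rw [e1, e2] at h
    have hI : ∫ x in (-1 : ℝ)..1, (rodriguesBase (n + 1)).eval x =
        -(2 * (n + 1)) / (2 * n + 3) *
          ((-1) ^ n * (2 ^ (2 * n + 1) * (n.factorial : ℝ) ^ 2 / ((2 * n + 1).factorial : ℝ))) := by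
      rw [div_mul_eq_mul_div, eq_div_iff (by positivity)]
      linarith
    rw [hI, show 2 * (n + 1) + 1 = 2 * n + 1 + 1 + 1 by ring, Nat.factorial_succ (2 * n + 1 + 1),
      Nat.factorial_succ (2 * n + 1), Nat.factorial_succ n]
    push_cast
    field_simp
    ring

theorem iterate_derivative_rodriguesPrimitive (n : ℕ) :
    derivative^[n + 1] (rodriguesPrimitive n) = C ((2 * n).factorial : ℝ) := by
  rw [Function.iterate_succ_apply, derivative_rodriguesPrimitive, ← Function.iterate_add_apply,
    ← two_mul, iterate_derivative_rodriguesBase]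

/-- The double integral `∫_{-1}^1 p_m(x) ∫_{-1}^x p_n(y) dy dx` for the unnormalized Legendre
polynomials `p_k = dᵏ/dxᵏ (x²−1)ᵏ`. -/
noncomputable def rodriguesDoubleIntegral (m n : ℕ) : ℝ :=
  ∫ x in (-1 : ℝ)..1, (derivative^[m] (rodriguesBase m) * rodriguesPrimitive n).eval x

theorem rodriguesDoubleIntegral_zero_zero : rodriguesDoubleIntegral 0 0 = 2 := by
  simp [rodriguesDoubleIntegral, rodriguesBase, rodriguesPrimitive]
  norm_num

theorem rodriguesDoubleIntegral_antisymm {m n : ℕ} (h : ¬(m = 0 ∧ n = 0)) :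
    rodriguesDoubleIntegral m n = -rodriguesDoubleIntegral n m := by
  have e : (rodriguesPrimitive m * rodriguesPrimitive n).eval 1 = 0 := by
    rw [eval_mul, mul_eq_zero]
    rcases not_and_or.mp h with h | h
    · exact .inl (rodriguesPrimitive_eval_one h)
    · exact .inr (rodriguesPrimitive_eval_one h)
  rw [rodriguesDoubleIntegral, ← derivative_rodriguesPrimitive, integral_derivative_mul_eval, e,
    eval_mul, rodriguesPrimitive_eval_neg_one, rodriguesDoubleIntegral,
    ← derivative_rodriguesPrimitive, mul_comm (rodriguesPrimitive m)]
  ring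

theorem rodriguesDoubleIntegral_eq_zero_of_lt {m n : ℕ} (h : n + 1 < m) :
    rodriguesDoubleIntegral m n = 0 := by
  obtain ⟨k, rfl⟩ := Nat.exists_eq_add_of_lt h
  rw [rodriguesDoubleIntegral, integral_iterate_derivative_rodriguesBase_mul le_rfl,
    show n + 1 + k + 1 = (k + 1) + (n + 1) by ring, Function.iterate_add_apply _ (k + 1),
    iterate_derivative_rodriguesPrimitive, iterate_derivative_C k.succ_pos]
  simp

theorem rodriguesDoubleIntegral_succ (n : ℕ) :
    rodriguesDoubleIntegral (n + 1) n = (2 * n).factorial *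
      (2 ^ (2 * n + 3) * ((n + 1).factorial : ℝ) ^ 2 / ((2 * n + 3).factorial : ℝ)) := by
  rw [rodriguesDoubleIntegral, integral_iterate_derivative_rodriguesBase_mul le_rfl,
    iterate_derivative_rodriguesPrimitive]
  simp only [eval_mul, eval_C]
  rw [intervalIntegral.integral_mul_const, integral_rodriguesBase, ← mul_assoc, ← mul_assoc,
    ← mul_pow]
  norm_num [mul_add]
  ring

theorem integral_legendreSys {t T : ℝ} (ht : t < T) (n : ℕ) (s : ℝ) :
    ∫ τ in t..s, legendreSys t T n τ =
      √((2 * n + 1) / (T - t)) * (1 / (2 ^ n * n.factorial : ℝ)) * ((T - t) / 2) *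
        (rodriguesPrimitive n).eval (2 / (T - t) * s - (T + t) / (T - t)) := by
  have hT : T - t ≠ 0 := (sub_pos.mpr ht).ne'
  have e (x : ℝ) : (2 * x - (T + t)) / (T - t) = 2 / (T - t) * x - (T + t) / (T - t) := by ring
  have e1 : 2 / (T - t) * t - (T + t) / (T - t) = -1 := by field_simp; ring
  simp only [legendreSys, legendreP_eq_eval, e, intervalIntegral.integral_const_mul]
  rw [intervalIntegral.integral_comp_mul_sub (fun x => (derivative^[n] (rodriguesBase n)).eval x)
    (by positivity), e1, ← derivative_rodriguesPrimitive,
    intervalIntegral.integral_eq_sub_of_hasDerivAt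
      (fun x _ => (rodriguesPrimitive n).hasDerivAt x)
      ((derivative (rodriguesPrimitive n)).continuous.intervalIntegrable _ _),
    rodriguesPrimitive_eval_neg_one, smul_eq_mul, inv_div]
  ring

theorem doubleCoef_eq {t T : ℝ} (ht : t < T) (m n : ℕ) :
    doubleCoef t T m n = √((2 * m + 1) / (T - t)) * √((2 * n + 1) / (T - t)) *
      ((T - t) / 2) ^ 2 * (1 / (2 ^ m * m.factorial : ℝ)) * (1 / (2 ^ n * n.factorial : ℝ)) *
        rodriguesDoubleIntegral m n := by
  have hT : T - t ≠ 0 := (sub_pos.mpr ht).ne'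
  have e (x : ℝ) : (2 * x - (T + t)) / (T - t) = 2 / (T - t) * x - (T + t) / (T - t) := by ring
  have e1 : 2 / (T - t) * t - (T + t) / (T - t) = -1 := by field_simp; ring
  have e2 : 2 / (T - t) * T - (T + t) / (T - t) = 1 := by field_simp; ring
  have key := intervalIntegral.integral_comp_mul_sub (a := t) (b := T) (c := 2 / (T - t))
    (fun x => (derivative^[m] (rodriguesBase m) * rodriguesPrimitive n).eval x)
    (by positivity) ((T + t) / (T - t))
  rw [e1, e2, smul_eq_mul, inv_div, ← rodriguesDoubleIntegral] at key
  rw [pow_two, show ∀ a b c d f g : ℝ, a * b * (c * c) * d * f * g = a * b * c * d * f * (c * g)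
    from fun _ _ _ _ _ _ => by ring, ← key, ← intervalIntegral.integral_const_mul, doubleCoef]
  congr 1
  ext s
  rw [integral_legendreSys ht, legendreSys, legendreP_eq_eval, e, eval_mul]
  ring

theorem doubleCoef_antisymm {t T : ℝ} (ht : t < T) {m n : ℕ} (h : ¬(m = 0 ∧ n = 0)) :
    doubleCoef t T m n = -doubleCoef t T n m := by
  rw [doubleCoef_eq ht, doubleCoef_eq ht, rodriguesDoubleIntegral_antisymm h]
  ring

theorem doubleCoef_succ {t T : ℝ} (ht : t < T) (n : ℕ) :
    doubleCoef t T (n + 1) n = (T - t) / (2 * √(4 * ((n + 1 : ℕ) : ℝ) ^ 2 - 1)) := by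
  have hT : 0 < T - t := sub_pos.mpr ht
  have hr : √((2 * ((n + 1 : ℕ) : ℝ) + 1) / (T - t)) * √((2 * n + 1) / (T - t)) =
      √(4 * ((n + 1 : ℕ) : ℝ) ^ 2 - 1) / (T - t) := by
    rw [← Real.sqrt_mul (by positivity), div_mul_div_comm, Real.sqrt_div' _ (by positivity),
      Real.sqrt_mul_self hT.le]
    congr 2
    push_cast
    ring
  have hp : (0 : ℝ) < 4 * ((n + 1 : ℕ) : ℝ) ^ 2 - 1 := by
    push_cast
    nlinarith [n.cast_nonneg (α := ℝ)]
  have hs := Real.sq_sqrt hp.le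
  have hs0 := Real.sqrt_pos.mpr hp
  rw [doubleCoef_eq ht, hr, rodriguesDoubleIntegral_succ]
  set r := √(4 * ((n + 1 : ℕ) : ℝ) ^ 2 - 1)
  have hrat : (1 / (2 ^ (n + 1) * (n + 1).factorial : ℝ)) * (1 / (2 ^ n * n.factorial : ℝ)) *
      ((2 * n).factorial *
        (2 ^ (2 * n + 3) * ((n + 1).factorial : ℝ) ^ 2 / ((2 * n + 3).factorial : ℝ))) =
      2 / r ^ 2 := by
    rw [hs, Nat.factorial_succ (2 * n + 2), Nat.factorial_succ (2 * n + 1),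
      Nat.factorial_succ (2 * n), Nat.factorial_succ n]
    have h1 : (4 * ((n + 1 : ℕ) : ℝ) ^ 2 - 1) = (2 * n + 1) * (2 * n + 3) := by push_cast; ring
    rw [h1]
    push_cast
    field_simp
    ring
  rw [mul_assoc, mul_assoc, ← mul_assoc (1 / _), hrat]
  field_simp

theorem stmt_5 (t T : ℝ) (ht : t < T) :
    doubleCoef t T 0 0 = (T - t) / 2 ∧
    (∀ j : ℕ, 1 ≤ j →
      doubleCoef t T j (j - 1) = (T - t) / (2 * Real.sqrt (4 * (j : ℝ) ^ 2 - 1)) ∧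
      doubleCoef t T (j - 1) j = -((T - t) / (2 * Real.sqrt (4 * (j : ℝ) ^ 2 - 1)))) ∧
    (∀ j₁ j₂ : ℕ, j₁ ≠ j₂ + 1 → j₂ ≠ j₁ + 1 → ¬(j₁ = 0 ∧ j₂ = 0) →
      doubleCoef t T j₂ j₁ = 0) := by
  have hT : 0 < T - t := sub_pos.mpr ht
  refine ⟨?_, fun j hj => ?_, fun j₁ j₂ h₁ h₂ h₀ => ?_⟩
  · rw [doubleCoef_eq ht, rodriguesDoubleIntegral_zero_zero, Real.mul_self_sqrt (by positivity)]
    simp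
    field_simp
  · obtain ⟨n, rfl⟩ := Nat.exists_eq_add_of_le' hj
    rw [Nat.add_sub_cancel, doubleCoef_antisymm ht (m := n) (by simp), doubleCoef_succ ht]
    exact ⟨rfl, rfl⟩
  · rcases lt_trichotomy j₁ j₂ with h | rfl | h
    · rw [doubleCoef_eq ht, rodriguesDoubleIntegral_eq_zero_of_lt (by omega), mul_zero]
    · linarith [doubleCoef_antisymm ht h₀]
    · rw [doubleCoef_antisymm ht (by omega), doubleCoef_eq ht,
        rodriguesDoubleIntegral_eq_zero_of_lt (by omega), mul_zero, neg_zero]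
end

section
/- Let t < T, let ψ_1, ψ_2, ψ_3, ψ_4 be continuously differentiable real functions on [t,T], let (φ_j)_{j≥0} be the normalized Legendre system on [t,T], and let C_{j_4 j_3 j_2 j_1} = ∫_t^T ψ_4(t_4)φ_{j_4}(t_4) ∫_t^{t_4} ψ_3(t_3)φ_{j_3}(t_3) ∫_t^{t_3} ψ_2(t_2)φ_{j_2}(t_2) ∫_t^{t_2} ψ_1(t_1)φ_{j_1}(t_1) dt_1 dt_2 dt_3 dt_4, and I_4 = ‖K‖²_{L²([t,T]⁴)} for the corresponding kernel K. Then for every ε ∈ (0,1) there exists a constant C, independent of p, such that for all integers p ≥ 1: 0 ≤ I_4 − Σ_{j_1,…,j_4=0}^{p} C_{j_4 j_3 j_2 j_1}² ≤ C/p^{1−ε}. -/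
open MeasureTheory

/-- The iterated simplex Fourier–Legendre coefficient
`C_{j_k…j_1} = ∫_t^T ψ_k(t_k)φ_{j_k}(t_k) ⋯ ∫_t^{t_2} ψ_1(t_1)φ_{j_1}(t_1) dt_1⋯dt_k`. -/
noncomputable def legCoef (t T : ℝ) {k : ℕ} (ψ : Fin k → ℝ → ℝ) (j : Fin k → ℕ) : ℝ :=
  simplexIntegral t
    ((List.ofFn fun l => fun s : ℝ => ψ l s * legendreSys t T (j l) s).reverse) T

section LegendrePolynomials

open Polynomial

theorem Polynomial.intervalIntegrable_eval (P : ℝ[X]) (a b : ℝ) :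
    IntervalIntegrable (fun x => P.eval x) volume a b :=
  P.continuous.intervalIntegrable a b

theorem Polynomial.integral_eval_derivative (P : ℝ[X]) (a b : ℝ) :
    ∫ x in a..b, (derivative P).eval x = P.eval b - P.eval a :=
  intervalIntegral.integral_eq_sub_of_hasDerivAt (fun x _ => P.hasDerivAt x)
    ((derivative P).intervalIntegrable_eval a b)

theorem Polynomial.integral_derivative_mul (P Q : ℝ[X]) (a b : ℝ) :
    ∫ x in a..b, (derivative P).eval x * Q.eval x =
      P.eval b * Q.eval b - P.eval a * Q.eval a - ∫ x in a..b, P.eval x * (derivative Q).eval x := by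
  have h := (P * Q).integral_eval_derivative a b
  simp only [derivative_mul, eval_add, eval_mul] at h
  rw [intervalIntegral.integral_add] at h
  · linarith
  · simpa using (derivative P * Q).intervalIntegrable_eval a b
  · simpa using (P * derivative Q).intervalIntegrable_eval a b

theorem Polynomial.integral_iterate_derivative_mul_eq_zero (W : ℝ[X]) {a b : ℝ} (n : ℕ)
    (ha : ∀ i < n, (derivative^[i] W).eval a = 0) (hb : ∀ i < n, (derivative^[i] W).eval b = 0)
    (q : ℝ[X]) (hq : derivative^[n] q = 0) :
    ∫ x in a..b, (derivative^[n] W).eval x * q.eval x = 0 := by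
  induction n generalizing q with
  | zero => simp_all
  | succ n ih =>
    rw [Function.iterate_succ_apply', integral_derivative_mul, ha n (by omega), hb n (by omega),
      ih (fun i hi => ha i (by omega)) (fun i hi => hb i (by omega)) (derivative q) (by simpa using hq)]
    ring

/-- The Legendre polynomial as a polynomial. -/
noncomputable def legendrePoly (n : ℕ) : ℝ[X] :=
  C (1 / (2 ^ n * (Nat.factorial n) : ℝ)) * derivative^[n] ((X ^ 2 - 1) ^ n)

theorem legendreP_eq_eval_s17 (n : ℕ) (x : ℝ) : legendreP n x = (legendrePoly n).eval x := by
  have h : ∀ P : ℝ[X], iteratedDeriv n (fun y => P.eval y) = fun y => (derivative^[n] P).eval y := by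
    intro P
    induction n with
    | zero => simp
    | succ n ih =>
      rw [iteratedDeriv_succ, ih]
      ext y
      simp [Function.iterate_succ_apply', -Function.iterate_succ]
  have h1 := h ((X ^ 2 - 1) ^ n)
  simp only [eval_pow, eval_sub, eval_X, eval_one] at h1
  rw [legendreP, legendrePoly, h1, eval_mul, eval_C]

theorem natDegree_legendrePoly_le (n : ℕ) : (legendrePoly n).natDegree ≤ n := by
  refine (natDegree_C_mul_le _ _).trans ((natDegree_iterate_derivative _ _).trans ?_)
  have : ((X ^ 2 - 1 : ℝ[X]) ^ n).natDegree ≤ n * 2 :=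
    natDegree_pow_le.trans (Nat.mul_le_mul_left _ (by compute_degree))
  omega

theorem sq_sub_one_pow_eq_one (n : ℕ) :
    (((X ^ 2 - 1 : ℝ[X]) ^ n).map (algebraMap ℝ ℝ)) = (X - C 1) ^ n * (X + C 1) ^ n := by
  rw [Algebra.algebraMap_self, map_id, ← mul_pow]
  congr 1
  simp
  ring

theorem sq_sub_one_pow_eq_neg_one (n : ℕ) :
    (((X ^ 2 - 1 : ℝ[X]) ^ n).map (algebraMap ℝ ℝ)) = (X - C (-1)) ^ n * (X - C 1) ^ n := by
  rw [Algebra.algebraMap_self, map_id, ← mul_pow]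
  congr 1
  simp
  ring

theorem eval_one_legendrePoly (n : ℕ) : (legendrePoly n).eval 1 = 1 := by
  have h := aeval_iterate_derivative_self ((X ^ 2 - 1 : ℝ[X]) ^ n) n (1 : ℝ)
    (sq_sub_one_pow_eq_one n)
  rw [coe_aeval_eq_eval] at h
  have hn : (n.factorial : ℝ) ≠ 0 := by positivity
  simp only [legendrePoly, eval_mul, eval_C, h]
  norm_num
  field_simp

theorem eval_neg_one_legendrePoly (n : ℕ) : (legendrePoly n).eval (-1) = (-1) ^ n := by
  have h := aeval_iterate_derivative_self ((X ^ 2 - 1 : ℝ[X]) ^ n) n (-1 : ℝ)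
    (sq_sub_one_pow_eq_neg_one n)
  rw [coe_aeval_eq_eval] at h
  have hn : (n.factorial : ℝ) ≠ 0 := by positivity
  simp only [legendrePoly, eval_mul, eval_C, h]
  norm_num
  rw [show (-2 : ℝ) = (-1) * 2 by norm_num, mul_pow]
  field_simp

theorem integral_legendrePoly_mul_eq_zero (n : ℕ) (q : ℝ[X]) (hq : q.degree < n) :
    ∫ x in (-1 : ℝ)..1, (legendrePoly n).eval x * q.eval x = 0 := by
  simp only [legendrePoly, eval_mul, eval_C, mul_assoc, intervalIntegral.integral_const_mul]
  rw [integral_iterate_derivative_mul_eq_zero, mul_zero]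
  · intro i hi
    have h := aeval_iterate_derivative_of_lt ((X ^ 2 - 1 : ℝ[X]) ^ n) n (-1 : ℝ)
      (sq_sub_one_pow_eq_neg_one n) hi
    rwa [coe_aeval_eq_eval] at h
  · intro i hi
    have h := aeval_iterate_derivative_of_lt ((X ^ 2 - 1 : ℝ[X]) ^ n) n (1 : ℝ)
      (sq_sub_one_pow_eq_one n) hi
    rwa [coe_aeval_eq_eval] at h
  · by_cases h0 : q = 0
    · simp [h0]
    · exact iterate_derivative_eq_zero ((natDegree_lt_iff_degree_lt h0).2 hq)

theorem integral_legendrePoly_sq (n : ℕ) :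
    ∫ x in (-1 : ℝ)..1, (legendrePoly n).eval x * (legendrePoly n).eval x = 2 / (2 * n + 1) := by
  set P := legendrePoly n with hP
  have hlow : (X * derivative P - C (n : ℝ) * P).degree < (n : WithBot ℕ) := by
    rw [degree_lt_iff_coeff_zero]
    intro m hm
    rw [coeff_sub, coeff_C_mul]
    rcases hm.eq_or_lt with rfl | hm
    · cases n with
      | zero => simp
      | succ n => rw [coeff_X_mul, coeff_derivative]; push_cast; ring
    · have h1 : P.coeff m = 0 :=
        coeff_eq_zero_of_natDegree_lt ((natDegree_legendrePoly_le n).trans_lt hm)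
      cases m with
      | zero => omega
      | succ m => rw [coeff_X_mul, coeff_derivative, h1]; simp
  have h1 := integral_legendrePoly_mul_eq_zero n _ hlow
  have h2 := (X * P).integral_derivative_mul P (-1) 1
  rw [← hP] at h1
  simp only [eval_mul, eval_X, derivative_mul, derivative_X, one_mul, eval_add, eval_sub, eval_C]
    at h1 h2
  have e1 : ∀ x : ℝ, P.eval x * (x * (derivative P).eval x - n * P.eval x) =
      x * P.eval x * (derivative P).eval x - n * (P.eval x * P.eval x) := fun x => by ring
  have e2 : ∀ x : ℝ, (P.eval x + x * (derivative P).eval x) * P.eval x =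
      P.eval x * P.eval x + x * P.eval x * (derivative P).eval x := fun x => by ring
  have i1 : IntervalIntegrable (fun x => P.eval x * P.eval x) volume (-1) 1 := by
    simpa using (P * P).intervalIntegrable_eval (-1) 1
  have i2 : IntervalIntegrable (fun x => x * P.eval x * (derivative P).eval x) volume (-1) 1 :=
    ((continuous_id.mul P.continuous).mul (derivative P).continuous).intervalIntegrable _ _
  simp only [e1, e2] at h1 h2
  rw [intervalIntegral.integral_sub i2 (i1.const_mul _), intervalIntegral.integral_const_mul] at h1
  rw [intervalIntegral.integral_add i1 i2, hP, eval_one_legendrePoly, eval_neg_one_legendrePoly,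
    ← hP] at h2
  have h3 : ((-1 : ℝ) ^ n) * (-1) ^ n = 1 := by rw [← mul_pow]; simp
  rw [eq_div_iff (by positivity)]
  linear_combination h2 - 2 * h1 + h3

theorem integral_legendrePoly_mul (m n : ℕ) :
    ∫ x in (-1 : ℝ)..1, (legendrePoly m).eval x * (legendrePoly n).eval x =
      if m = n then 2 / (2 * (n : ℝ) + 1) else 0 := by
  have key : ∀ m n : ℕ, m < n →
      ∫ x in (-1 : ℝ)..1, (legendrePoly n).eval x * (legendrePoly m).eval x = 0 := by
    intro m n h
    refine integral_legendrePoly_mul_eq_zero n _ ?_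
    refine (degree_le_of_natDegree_le (natDegree_legendrePoly_le m)).trans_lt ?_
    exact_mod_cast h
  split_ifs with h
  · rw [h, integral_legendrePoly_sq]
  · rcases lt_or_gt_of_ne h with h | h
    · rw [← key m n h]
      simp only [mul_comm]
    · exact key n m h

theorem coeff_legendrePoly_ne_zero (n : ℕ) : (legendrePoly n).coeff n ≠ 0 := by
  intro h
  have hd : (legendrePoly n).degree < n := by
    rw [degree_lt_iff_coeff_zero]
    intro m hm
    rcases hm.eq_or_lt with rfl | hm
    · exact h
    · exact coeff_eq_zero_of_natDegree_lt ((natDegree_legendrePoly_le n).trans_lt hm)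
  have h1 := integral_legendrePoly_mul_eq_zero n _ hd
  rw [integral_legendrePoly_sq] at h1
  have : (0 : ℝ) < 2 / (2 * n + 1) := by positivity
  linarith

theorem continuous_legendreSys (t T : ℝ) (j : ℕ) : Continuous (legendreSys t T j) := by
  unfold legendreSys
  simp only [legendreP_eq_eval_s17]
  exact continuous_const.mul ((legendrePoly j).continuous.comp (by fun_prop))

theorem integral_legendreSys_mul {t T : ℝ} (ht : t < T) (i j : ℕ) :
    ∫ x in Set.Icc t T, legendreSys t T i x * legendreSys t T j x = if i = j then 1 else 0 := by
  have hD : 0 < T - t := sub_pos.2 ht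
  rw [integral_Icc_eq_integral_Ioc, ← intervalIntegral.integral_of_le ht.le]
  have e : ∀ x, legendreSys t T i x * legendreSys t T j x =
      √((2 * (i : ℝ) + 1) / (T - t)) * √((2 * (j : ℝ) + 1) / (T - t)) *
      (fun y => (legendrePoly i).eval y * (legendrePoly j).eval y)
        (2 / (T - t) * x + -(T + t) / (T - t)) := by
    intro x
    have : (2 * x - (T + t)) / (T - t) = 2 / (T - t) * x + -(T + t) / (T - t) := by ring
    simp only [legendreSys, legendreP_eq_eval_s17, this]
    ring
  simp only [e]
  rw [intervalIntegral.integral_const_mul, intervalIntegral.integral_comp_mul_add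
      (fun y => (legendrePoly i).eval y * (legendrePoly j).eval y) (by positivity),
    show 2 / (T - t) * t + -(T + t) / (T - t) = -1 by field_simp; ring,
    show 2 / (T - t) * T + -(T + t) / (T - t) = 1 by field_simp; ring, integral_legendrePoly_mul]
  split_ifs with h
  · subst h
    rw [Real.mul_self_sqrt (by positivity)]
    simp only [smul_eq_mul]
    field_simp
  · simp

/-- Polynomials of degree at most `p` are combinations of the first `p + 1` normalized Legendre
functions. -/
theorem exists_eval_eq_sum_legendreSys {t T : ℝ} (ht : t < T) (p : ℕ) (q : ℝ[X])
    (hq : q.natDegree ≤ p) :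
    ∃ b : Fin (p + 1) → ℝ, ∀ x, q.eval x = ∑ i, b i * legendreSys t T i x := by
  have hD : 0 < T - t := sub_pos.2 ht
  let L : ℝ[X] := C (2 / (T - t)) * X + C (-(T + t) / (T - t))
  let E : ℕ → ℝ[X] := fun j => C √((2 * (j : ℝ) + 1) / (T - t)) * (legendrePoly j).comp L
  have hL : L.natDegree = 1 := natDegree_linear (by positivity)
  have hEeval : ∀ j x, (E j).eval x = legendreSys t T j x := by
    intro j x
    simp only [E, L, legendreSys, legendreP_eq_eval_s17, eval_mul, eval_C, eval_comp, eval_add, eval_X]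
    congr 2
    ring
  have hdeg : ∀ j, (legendrePoly j).natDegree = j := fun j =>
    natDegree_eq_of_le_of_coeff_ne_zero (natDegree_legendrePoly_le j) (coeff_legendrePoly_ne_zero j)
  have hEdeg : ∀ j, (E j).natDegree = j := by
    intro j
    simp only [E]
    rw [natDegree_C_mul (by positivity), natDegree_comp, hL, hdeg, mul_one]
  have hE0 : ∀ j, (E j).coeff j ≠ 0 := by
    intro j h0
    have h2 : (E j).leadingCoeff = 0 := by rw [leadingCoeff, hEdeg, h0]
    rw [leadingCoeff_eq_zero] at h2
    have h3 : (legendrePoly j).comp L ≠ 0 := by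
      intro h
      rw [comp_eq_zero_iff] at h
      rcases h with h | ⟨-, h⟩
      · exact coeff_legendrePoly_ne_zero j (by simp [h])
      · rw [h, natDegree_C] at hL
        omega
    simp only [E, mul_eq_zero, C_eq_zero, h3, or_false] at h2
    exact (Real.sqrt_pos.2 (by positivity : 0 < (2 * (j : ℝ) + 1) / (T - t))).ne' h2
  have key : ∀ n ≤ p + 1, ∀ q : ℝ[X], q.degree < n →
      ∃ b : Fin (p + 1) → ℝ, q = ∑ i, C (b i) * E i := by
    intro n
    induction n with
    | zero =>
      intro _ q hq
      refine ⟨0, ?_⟩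
      simpa [degree_lt_iff_coeff_zero, Polynomial.ext_iff] using hq
    | succ n ih =>
      intro hn q hq
      obtain ⟨b, hb⟩ := ih (by omega) (q - C (q.coeff n / (E n).coeff n) * E n) (by
        rw [degree_lt_iff_coeff_zero] at hq ⊢
        intro m hm
        rcases hm.eq_or_lt with rfl | hm
        · simp [hE0]
        · rw [coeff_sub, coeff_C_mul, hq m (by omega),
            coeff_eq_zero_of_natDegree_lt (p := E n) (n := m) (by rw [hEdeg]; exact hm)]
          simp)
      refine ⟨b + Pi.single ⟨n, by omega⟩ (q.coeff n / (E n).coeff n), ?_⟩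
      simp only [Pi.add_apply, C_add, add_mul, Finset.sum_add_distrib, ← hb]
      rw [Finset.sum_eq_single (⟨n, by omega⟩ : Fin (p + 1))]
      · simp
      · intro i _ hi
        simp [hi]
      · simp
  obtain ⟨b, hb⟩ := key (p + 1) le_rfl q
    ((degree_le_of_natDegree_le hq).trans_lt (by exact_mod_cast Nat.lt_succ_self p))
  refine ⟨b, fun x => ?_⟩
  conv_lhs => rw [hb]
  simp [eval_finsetSum, hEeval]

end LegendrePolynomials

section SimplexIntegral

instance (t T : ℝ) (k : ℕ) : IsFiniteMeasure (boxMeasure t T k) := by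
  unfold boxMeasure
  infer_instance

theorem measurePreserving_insertNth_boxMeasure (t T : ℝ) {k : ℕ} (i : Fin (k + 1)) :
    MeasurePreserving (MeasurableEquiv.piFinSuccAbove (fun _ => ℝ) i).symm
      ((volume.restrict (Set.Icc t T)).prod (boxMeasure t T k)) (boxMeasure t T (k + 1)) :=
  (measurePreserving_piFinSuccAbove (fun _ => volume.restrict (Set.Icc t T)) i).symm

theorem integrable_comp_insertNth {t T : ℝ} {k : ℕ} (i : Fin (k + 1)) {F : (Fin (k + 1) → ℝ) → ℝ}
    (hF : Integrable F (boxMeasure t T (k + 1))) :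
    Integrable (fun z : ℝ × (Fin k → ℝ) => F (i.insertNth z.1 z.2))
      ((volume.restrict (Set.Icc t T)).prod (boxMeasure t T k)) :=
  (measurePreserving_insertNth_boxMeasure t T i).integrable_comp_of_integrable hF

theorem integral_boxMeasure_eq_integral_prod {t T : ℝ} {k : ℕ} (i : Fin (k + 1))
    (F : (Fin (k + 1) → ℝ) → ℝ) :
    ∫ x, F x ∂boxMeasure t T (k + 1) =
      ∫ z : ℝ × (Fin k → ℝ), F (i.insertNth z.1 z.2)
        ∂((volume.restrict (Set.Icc t T)).prod (boxMeasure t T k)) :=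
  ((measurePreserving_insertNth_boxMeasure t T i).integral_comp' F).symm

theorem strictMono_snoc_iff {k : ℕ} (y : Fin k → ℝ) (s : ℝ) :
    StrictMono (Fin.snoc y s : Fin (k + 1) → ℝ) ↔ StrictMono y ∧ ∀ i, y i < s := by
  constructor
  · intro h
    refine ⟨fun i j hij => ?_, fun i => ?_⟩
    · simpa using h (Fin.castSucc_lt_castSucc_iff.2 hij)
    · simpa using h (Fin.castSucc_lt_last i)
  · rintro ⟨h1, h2⟩ i j hij
    induction j using Fin.lastCases with
    | last =>
      induction i using Fin.lastCases with
      | last => exact absurd hij (lt_irrefl _)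
      | cast i => simpa using h2 i
    | cast j =>
      induction i using Fin.lastCases with
      | last => exact absurd hij (not_lt.2 (Fin.le_last _))
      | cast i => simpa using h1 (Fin.castSucc_lt_castSucc_iff.1 hij)

theorem kernelK_snoc {k : ℕ} (f : Fin (k + 1) → ℝ → ℝ) (y : Fin k → ℝ) (s : ℝ) :
    kernelK f (Fin.snoc y s) = f (Fin.last k) s *
      (Set.univ.pi fun _ => Set.Iio s).indicator (kernelK fun i => f i.castSucc) y := by
  classical
  have hmem : y ∈ (Set.univ.pi fun _ : Fin k => Set.Iio s) ↔ ∀ i, y i < s := by simp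
  simp only [kernelK, strictMono_snoc_iff, Set.indicator_apply, hmem, Fin.prod_univ_castSucc,
    Fin.snoc_castSucc, Fin.snoc_last]
  split_ifs <;> simp_all [mul_comm]

theorem measurableSet_strictMono (k : ℕ) : MeasurableSet {x : Fin k → ℝ | StrictMono x} := by
  have : {x : Fin k → ℝ | StrictMono x} =
      ⋂ i : Fin k, ⋂ j : Fin k, ⋂ _ : i < j, {x | x i < x j} := by
    ext x
    simp [StrictMono]
  rw [this]
  exact MeasurableSet.iInter fun i => MeasurableSet.iInter fun j => MeasurableSet.iInter fun _ =>
    measurableSet_lt (measurable_pi_apply i) (measurable_pi_apply j)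

theorem kernelK_eq_indicator {k : ℕ} (f : Fin k → ℝ → ℝ) :
    kernelK f = {x | StrictMono x}.indicator fun x => ∏ l, f l (x l) := by
  classical
  ext x
  simp [kernelK, Set.indicator_apply]

theorem integrable_kernelK {t T : ℝ} {k : ℕ} {f : Fin k → ℝ → ℝ}
    (hf : ∀ l, IntegrableOn (f l) (Set.Icc t T)) : Integrable (kernelK f) (boxMeasure t T k) := by
  rw [kernelK_eq_indicator]
  exact (Integrable.fintype_prod hf).indicator (measurableSet_strictMono k)

theorem boxMeasure_restrict_Iio {t b s : ℝ} (k : ℕ) (hs : s ≤ b) :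
    (boxMeasure t b k).restrict (Set.univ.pi fun _ => Set.Iio s) = boxMeasure t s k := by
  rw [boxMeasure, boxMeasure, Measure.restrict_pi_pi]
  congr 1
  ext1 _
  rw [Measure.restrict_restrict measurableSet_Iio]
  have : Set.Iio s ∩ Set.Icc t b = Set.Ico t s := by
    ext x
    simp only [Set.mem_inter_iff, Set.mem_Iio, Set.mem_Icc, Set.mem_Ico]
    constructor
    · tauto
    · rintro ⟨h1, h2⟩
      exact ⟨h2, h1, by linarith⟩
  rw [this]
  exact Measure.restrict_congr_set Ico_ae_eq_Icc

theorem integral_kernelK_eq_simplexIntegral {t b : ℝ} (hb : t ≤ b) {k : ℕ} {f : Fin k → ℝ → ℝ}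
    (hf : ∀ l, IntegrableOn (f l) (Set.Icc t b)) :
    ∫ x, kernelK f x ∂boxMeasure t b k = simplexIntegral t (List.ofFn f).reverse b := by
  induction k generalizing b with
  | zero => simp [simplexIntegral, kernelK, boxMeasure, StrictMono, measureReal_def]
  | succ k ih =>
    rw [List.ofFn_succ', List.concat_eq_append, List.reverse_append, List.reverse_singleton,
      List.singleton_append, simplexIntegral, integral_boxMeasure_eq_integral_prod (Fin.last k),
      integral_prod _ (integrable_comp_insertNth _ (integrable_kernelK hf)),
      intervalIntegral.integral_of_le hb, ← integral_Icc_eq_integral_Ioc]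
    refine setIntegral_congr_fun measurableSet_Icc fun s hs => ?_
    simp only [Fin.insertNth_last', kernelK_snoc]
    rw [integral_const_mul, integral_indicator
      (MeasurableSet.univ_pi fun _ => measurableSet_Iio), boxMeasure_restrict_Iio k hs.2,
      ih hs.1 fun l => (hf l.castSucc).mono_set (Set.Icc_subset_Icc_right hs.2)]

end SimplexIntegral

section StepApproximation

open Polynomial

theorem exists_eval_sin_mul_sin (r : ℕ) :
    ∃ S : ℝ[X], S.natDegree ≤ 2 * r ∧
      (∀ θ : ℝ, S.eval (Real.sin θ) * Real.sin θ = Real.sin ((2 * r + 1) * θ)) ∧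
      ∀ θ : ℝ, |S.eval (Real.sin θ)| ≤ 2 * r + 1 := by
  induction r with
  | zero => exact ⟨1, by simp, fun θ => by simp, fun θ => by simp⟩
  | succ r ih =>
    obtain ⟨S, hdeg, hsin, hbd⟩ := ih
    have hT : ∀ θ : ℝ, ((Chebyshev.T ℝ ((r + 1 : ℕ) : ℤ)).comp (1 - C 2 * X ^ 2)).eval
        (Real.sin θ) = Real.cos ((r + 1) * (2 * θ)) := by
      intro θ
      have h : (1 : ℝ) - 2 * Real.sin θ ^ 2 = Real.cos (2 * θ) := by
        rw [Real.cos_two_mul, Real.cos_sq']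
        ring
      simp only [eval_comp, eval_sub, eval_one, eval_mul, eval_C, eval_pow, eval_X, h]
      rw [Chebyshev.T_real_cos]
      push_cast
      rfl
    refine ⟨S + C 2 * (Chebyshev.T ℝ ((r + 1 : ℕ) : ℤ)).comp (1 - C 2 * X ^ 2), ?_, ?_, ?_⟩
    · refine natDegree_add_le_of_degree_le (hdeg.trans (by omega)) ?_
      refine (natDegree_C_mul_le _ _).trans (natDegree_comp_le.trans ?_)
      have h2 : (1 - C 2 * X ^ 2 : ℝ[X]).natDegree ≤ 2 := by compute_degree
      have h1 : (Chebyshev.T ℝ ((r + 1 : ℕ) : ℤ)).natDegree = r + 1 := by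
        rw [Chebyshev.natDegree_T, Int.natAbs_natCast]
      rw [h1, mul_comm]
      exact Nat.mul_le_mul_right _ h2
    · intro θ
      have h3 := Real.sin_sub_sin ((2 * (r + 1 : ℝ) + 1) * θ) ((2 * r + 1) * θ)
      rw [show ((2 * (r + 1 : ℝ) + 1) * θ - (2 * r + 1) * θ) / 2 = θ by ring,
        show ((2 * (r + 1 : ℝ) + 1) * θ + (2 * r + 1) * θ) / 2 = (r + 1) * (2 * θ) by ring] at h3
      rw [eval_add, eval_mul, eval_C, hT]
      push_cast
      linear_combination hsin θ - h3
    · intro θ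
      rw [eval_add, eval_mul, eval_C, hT]
      refine (abs_add_le _ _).trans ?_
      rw [abs_mul, abs_two]
      have := hbd θ
      have := Real.abs_cos_le_one ((r + 1) * (2 * θ))
      push_cast
      linarith

theorem Polynomial.exists_derivative_eq (P : ℝ[X]) :
    ∃ Q : ℝ[X], derivative Q = P ∧ Q.natDegree ≤ P.natDegree + 1 := by
  refine ⟨∑ i ∈ Finset.range (P.natDegree + 1), C (P.coeff i / (i + 1)) * X ^ (i + 1), ?_, ?_⟩
  · conv_rhs => rw [P.as_sum_range_C_mul_X_pow]
    rw [derivative_sum]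
    refine Finset.sum_congr rfl fun i _ => ?_
    rw [derivative_C_mul_X_pow]
    push_cast
    rw [div_mul_cancel₀ _ (by positivity)]
  · refine natDegree_sum_le_of_forall_le _ _ fun i hi => ?_
    refine (natDegree_C_mul_X_pow_le _ _).trans ?_
    have := Finset.mem_range.1 hi
    omega

/-- A nonnegative polynomial concentrated at the origin at scale `1 / (2 r + 1)`. -/
theorem exists_concentrated_polynomial (r : ℕ) :
    ∃ k : ℝ[X], k.natDegree ≤ 8 * r ∧ (∀ x, 0 ≤ k.eval x) ∧
      (∀ x : ℝ, |x| ≤ 1 → k.eval x ≤ 4 * (2 * r + 1) ^ 4 / (1 + (2 * r + 1) ^ 2 * x ^ 2) ^ 2) ∧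
      ∀ x : ℝ, 0 < x → x ≤ 1 / (2 * r + 1) → (2 * r + 1) ^ 4 / 16 ≤ k.eval x := by
  obtain ⟨S, hdeg, hsin, hbd⟩ := exists_eval_sin_mul_sin r
  set m : ℝ := 2 * r + 1 with hm
  have hm1 : 1 ≤ m := by rw [hm]; linarith [(Nat.cast_nonneg r : (0 : ℝ) ≤ r)]
  refine ⟨S ^ 4, ?_, fun x => ?_, fun x hx => ?_, fun x hx0 hx => ?_⟩
  · refine natDegree_pow_le.trans ?_
    omega
  · rw [eval_pow]
    positivity
  · obtain ⟨h1, h2⟩ := abs_le.1 hx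
    have hs := Real.sin_arcsin h1 h2
    have e1 := hsin (Real.arcsin x)
    have e2 := hbd (Real.arcsin x)
    rw [hs] at e1 e2
    have e3 : (S.eval x * x) ^ 2 ≤ 1 := by
      rw [e1]
      exact Real.sin_sq_le_one _
    have e4 : (S.eval x) ^ 2 ≤ m ^ 2 := sq_le_sq' (abs_le.1 e2).1 (abs_le.1 e2).2
    have e5 : (S.eval x) ^ 2 * (1 + m ^ 2 * x ^ 2) ≤ 2 * m ^ 2 := by nlinarith [sq_nonneg m]
    rw [le_div_iff₀ (by positivity), eval_pow]
    have e6 := pow_le_pow_left₀ (by positivity) e5 2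
    calc _ = ((S.eval x) ^ 2 * (1 + m ^ 2 * x ^ 2)) ^ 2 := by ring
      _ ≤ _ := e6
      _ = _ := by ring
  · have hx1 : x ≤ 1 := hx.trans ((div_le_one (by linarith)).2 hm1)
    have hs := Real.sin_arcsin (by linarith : -1 ≤ x) hx1
    set θ := Real.arcsin x
    have hθ0 : 0 ≤ θ := Real.arcsin_nonneg.2 hx0.le
    have hmθ : m * θ ≤ Real.pi / 2 := by
      have h1 : θ ≤ Real.pi / 2 := Real.arcsin_le_pi_div_two x
      have : θ ≤ Real.pi / (2 * m) := by
        have h0 : 0 ≤ Real.pi / (2 * m) := by positivity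
        have h0' : Real.pi / (2 * m) ≤ Real.pi / 2 := by gcongr; linarith
        rw [← Real.arcsin_sin (x := Real.pi / (2 * m)) (by linarith [Real.pi_pos]) h0']
        refine Real.monotone_arcsin ?_
        refine hx.trans (le_trans (le_of_eq ?_) (Real.mul_le_sin h0 h0'))
        have := Real.pi_pos
        field_simp
      rw [le_div_iff₀ (by positivity)] at this
      linarith
    have h3 := Real.mul_le_sin (x := m * θ) (by positivity) hmθ
    have h4 : Real.sin θ ≤ θ := Real.sin_le hθ0
    have e1 := hsin θ
    rw [hs] at e1 h4
    have h5 : m / 2 ≤ S.eval x := by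
      have hpi : 1 / 2 ≤ 2 / Real.pi := by
        rw [div_le_div_iff₀ (by norm_num) Real.pi_pos]
        linarith [Real.pi_le_four]
      have : m / 2 * x ≤ S.eval x * x := by
        rw [e1]
        refine le_trans ?_ h3
        have : 1 / 2 * (m * x) ≤ 2 / Real.pi * (m * θ) := by gcongr
        linarith
      exact le_of_mul_le_mul_right this hx0
    rw [eval_pow]
    calc m ^ 4 / 16 = (m / 2) ^ 4 := by ring
      _ ≤ _ := pow_le_pow_left₀ (by positivity) h5 4

theorem hasDerivAt_neg_two_mul_sq_div (m x : ℝ) :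
    HasDerivAt (fun x : ℝ => -(2 * m ^ 2) / (1 + m ^ 2 * x ^ 2))
      (4 * m ^ 4 / (1 + m ^ 2 * x ^ 2) ^ 2 * x) x := by
  have h0 : 1 + m ^ 2 * x ^ 2 ≠ 0 := by positivity
  have h1 : HasDerivAt (fun x : ℝ => 1 + m ^ 2 * x ^ 2) (m ^ 2 * (2 * x)) x := by
    simpa using ((hasDerivAt_pow 2 x).const_mul (m ^ 2)).const_add 1
  refine ((hasDerivAt_const x (-(2 * m ^ 2))).div h1 h0).congr_deriv ?_
  field_simp
  ring

/-- Polynomial approximation of the Heaviside function on `[-1, 1]`. -/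
theorem exists_step_polynomial (r : ℕ) :
    ∃ h : ℝ[X], h.natDegree ≤ 8 * r + 1 ∧
      (∀ x : ℝ, |x| ≤ 1 → 0 ≤ h.eval x ∧ h.eval x ≤ 1) ∧
      ∫ x in (-1 : ℝ)..1, |h.eval x - if 0 < x then 1 else 0| ≤ 64 / (2 * r + 1) := by
  obtain ⟨k, hkdeg, hk0, hkle, hkge⟩ := exists_concentrated_polynomial r
  obtain ⟨Q, hQ, hQdeg⟩ := k.exists_derivative_eq
  set m : ℝ := 2 * r + 1 with hm
  have hm1 : 1 ≤ m := by rw [hm]; linarith [(Nat.cast_nonneg r : (0 : ℝ) ≤ r)]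
  have hmono : Monotone fun x => Q.eval x := by
    refine monotone_of_deriv_nonneg Q.differentiable fun x => ?_
    rw [Q.deriv, hQ]
    exact hk0 x
  have hm2 : 1 / m ≤ 1 := (div_le_one (by linarith)).2 hm1
  have hm3 : 0 < 1 / m := by positivity
  set Z := Q.eval 1 - Q.eval (-1) with hZ
  have hZm : m ^ 3 / 16 ≤ Z := by
    have h1 : ∫ _ in (0 : ℝ)..(1 / m), m ^ 4 / 16 ≤ ∫ x in (0 : ℝ)..(1 / m), k.eval x := by
      refine intervalIntegral.integral_mono_on_of_le_Ioo hm3.le (by simp)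
        (k.intervalIntegrable_eval _ _) fun x hx => ?_
      exact hkge x hx.1 hx.2.le
    rw [← hQ, Q.integral_eval_derivative, intervalIntegral.integral_const] at h1
    have h2 := hmono hm2
    have h3 := hmono (by norm_num : (-1 : ℝ) ≤ 0)
    simp only at h2 h3
    have h4 : (1 / m - 0) • (m ^ 4 / 16) = m ^ 3 / 16 := by
      rw [smul_eq_mul]
      field_simp
      ring
    linarith
  have hZ0 : 0 < Z := lt_of_lt_of_le (by positivity) hZm
  set h : ℝ[X] := C (1 / Z) * (Q - C (Q.eval (-1))) with hh
  have hev : ∀ x, h.eval x = (Q.eval x - Q.eval (-1)) / Z := fun x => by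
    simp only [hh, eval_mul, eval_C, eval_sub]
    ring
  have hder : derivative h = C (1 / Z) * k := by
    simp [hh, hQ]
  have hbd : ∀ x : ℝ, |x| ≤ 1 → 0 ≤ h.eval x ∧ h.eval x ≤ 1 := by
    intro x hx
    obtain ⟨h1, h2⟩ := abs_le.1 hx
    have h3 := hmono h1
    have h4 := hmono h2
    simp only at h3 h4
    rw [hev]
    exact ⟨div_nonneg (by linarith) hZ0.le, (div_le_one hZ0).2 (by rw [hZ]; linarith)⟩
  have hmneg : h.eval (-1) = 0 := by rw [hev]; simp
  have hone : h.eval 1 = 1 := by rw [hev, ← hZ, div_self hZ0.ne']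
  have hcont : Continuous fun x : ℝ => 4 * m ^ 4 / (1 + m ^ 2 * x ^ 2) ^ 2 := by
    refine continuous_const.div (by fun_prop) fun x => by positivity
  have hint : ∀ a b : ℝ, ∫ x in a..b, 4 * m ^ 4 / (1 + m ^ 2 * x ^ 2) ^ 2 * x =
      -(2 * m ^ 2) / (1 + m ^ 2 * b ^ 2) - -(2 * m ^ 2) / (1 + m ^ 2 * a ^ 2) := fun a b =>
    intervalIntegral.integral_eq_sub_of_hasDerivAt
      (fun x _ => hasDerivAt_neg_two_mul_sq_div m x)
      ((hcont.mul continuous_id).intervalIntegrable _ _)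
  have hxk : Continuous fun x : ℝ => k.eval x * x := k.continuous.mul continuous_id
  have hneg0 : -(2 * m ^ 2) / (1 + m ^ 2) ≤ 0 :=
    div_nonpos_of_nonpos_of_nonneg (by nlinarith) (by positivity)
  have hright : ∫ x in (0 : ℝ)..1, k.eval x * x ≤ 2 * m ^ 2 := by
    refine (intervalIntegral.integral_mono_on zero_le_one (hxk.intervalIntegrable _ _)
      ((hcont.mul continuous_id).intervalIntegrable _ _) fun x hx => ?_).trans
        ((hint 0 1).le.trans ?_)
    · exact mul_le_mul_of_nonneg_right (hkle x (abs_le.2 ⟨by linarith [hx.1], hx.2⟩)) hx.1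
    · norm_num
      exact hneg0
  have hleft : -(2 * m ^ 2) ≤ ∫ x in (-1 : ℝ)..0, k.eval x * x := by
    refine le_trans ?_ ((hint (-1) 0).ge.trans (intervalIntegral.integral_mono_on (by norm_num)
      ((hcont.mul continuous_id).intervalIntegrable _ _) (hxk.intervalIntegrable _ _)
      fun x hx => ?_))
    · norm_num
      exact hneg0
    · exact mul_le_mul_of_nonpos_right (hkle x (abs_le.2 ⟨hx.1, by linarith [hx.2]⟩)) hx.2
  have hL : ∫ x in (-1 : ℝ)..0, |h.eval x - if 0 < x then 1 else 0| ≤ 2 * m ^ 2 / Z := by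
    have h1 : ∫ x in (-1 : ℝ)..0, |h.eval x - if 0 < x then 1 else 0| =
        ∫ x in (-1 : ℝ)..0, h.eval x := by
      refine intervalIntegral.integral_congr fun x hx => ?_
      rw [Set.uIcc_of_le (by norm_num)] at hx
      simp only [not_lt.2 hx.2, if_false, sub_zero]
      exact abs_of_nonneg (hbd x (abs_le.2 ⟨hx.1, by linarith [hx.2]⟩)).1
    have h2 := (X : ℝ[X]).integral_derivative_mul h (-1) 0
    simp only [derivative_X, eval_one, one_mul, eval_X, hder, eval_mul, eval_C, hmneg] at h2
    rw [h1, h2]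
    have h3 : ∀ x : ℝ, x * (1 / Z * k.eval x) = 1 / Z * (k.eval x * x) := fun x => by ring
    simp only [h3, intervalIntegral.integral_const_mul]
    rw [le_div_iff₀ hZ0]
    field_simp
    linarith
  have hR : ∫ x in (0 : ℝ)..1, |h.eval x - if 0 < x then 1 else 0| ≤ 2 * m ^ 2 / Z := by
    have h1 : ∫ x in (0 : ℝ)..1, |h.eval x - if 0 < x then 1 else 0| =
        ∫ x in (0 : ℝ)..1, (1 - h).eval x := by
      rw [intervalIntegral.integral_of_le zero_le_one, intervalIntegral.integral_of_le zero_le_one]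
      refine setIntegral_congr_fun measurableSet_Ioc fun x hx => ?_
      simp only [hx.1, if_true, eval_sub, eval_one]
      rw [abs_sub_comm]
      exact abs_of_nonneg (by linarith [(hbd x (abs_le.2 ⟨by linarith [hx.1], hx.2⟩)).2])
    have h2 := (X : ℝ[X]).integral_derivative_mul (1 - h) 0 1
    simp only [derivative_X, eval_one, one_mul, eval_X, hder, eval_mul, eval_C, hone, eval_sub,
      derivative_sub, derivative_one, eval_zero] at h2
    simp only [eval_sub, eval_one] at h1
    rw [h1, h2]
    have h3 : ∀ x : ℝ, x * (0 - 1 / Z * k.eval x) = -(1 / Z) * (k.eval x * x) := fun x => by ring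
    simp only [h3, intervalIntegral.integral_const_mul]
    rw [le_div_iff₀ hZ0]
    field_simp
    linarith
  have hii : ∀ a b : ℝ, IntervalIntegrable (fun x => |h.eval x - if 0 < x then 1 else 0|)
      volume a b := by
    intro a b
    have h1 : IntervalIntegrable (fun x : ℝ => if 0 < x then (1 : ℝ) else 0) volume a b := by
      refine Monotone.intervalIntegrable fun x y hxy => ?_
      split_ifs <;> linarith
    exact ((h.intervalIntegrable_eval a b).sub h1).abs
  refine ⟨h, ?_, hbd, ?_⟩
  · refine (natDegree_C_mul_le _ _).trans ((natDegree_sub_C (a := Q.eval (-1))).le.trans ?_)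
    omega
  · rw [← intervalIntegral.integral_add_adjacent_intervals (hii (-1) 0) (hii 0 1)]
    refine (add_le_add hL hR).trans ?_
    rw [← add_div, div_le_div_iff₀ hZ0 (by positivity)]
    nlinarith [pow_pos (by linarith : 0 < m) 2]

end StepApproximation

section BernsteinApproximation

open Polynomial

theorem natDegree_bernsteinPolynomial_le (n k : ℕ) (hk : k ≤ n) :
    (bernsteinPolynomial ℝ n k).natDegree ≤ n := by
  have h1 : ((1 - X : ℝ[X]) ^ (n - k)).natDegree ≤ n - k := by
    refine natDegree_pow_le.trans ?_
    have : (1 - X : ℝ[X]).natDegree ≤ 1 := by compute_degree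
    nlinarith
  have h2 : ((n.choose k : ℝ[X]) * X ^ k).natDegree ≤ k := by
    rw [← C_eq_natCast]
    exact natDegree_C_mul_X_pow_le _ _
  exact natDegree_mul_le.trans (by omega)

theorem exists_polynomial_near_of_lipschitzOnWith {t T : ℝ} (ht : t < T) {f : ℝ → ℝ} {L : NNReal}
    (hf : LipschitzOnWith L f (Set.Icc t T)) {M : ℝ} (hM : ∀ x ∈ Set.Icc t T, |f x| ≤ M)
    {n : ℕ} (hn : n ≠ 0) :
    ∃ q : ℝ[X], q.natDegree ≤ n ∧ ∀ x ∈ Set.Icc t T,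
      |q.eval x| ≤ M ∧ (f x - q.eval x) ^ 2 ≤ (L * (T - t)) ^ 2 / n := by
  have hD : 0 < T - t := sub_pos.2 ht
  let node : Fin (n + 1) → ℝ := fun k => t + (T - t) * (bernstein.z k : ℝ)
  have hnode : ∀ k, node k ∈ Set.Icc t T := fun k => by
    have h0 := (bernstein.z k).2.1
    have h1 := (bernstein.z k).2.2
    constructor
    · have := mul_nonneg hD.le h0
      simp only [node]
      linarith
    · have := mul_le_mul_of_nonneg_left h1 hD.le
      simp only [node]
      linarith
  refine ⟨∑ k : Fin (n + 1), C (f (node k)) *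
    (bernsteinPolynomial ℝ n k).comp (C (1 / (T - t)) * X + C (-t / (T - t))), ?_, fun x hx => ?_⟩
  · refine natDegree_sum_le_of_forall_le _ _ fun k _ => (natDegree_C_mul_le _ _).trans
      (natDegree_comp_le.trans ?_)
    have h1 := natDegree_bernsteinPolynomial_le n k (Nat.lt_succ_iff.1 k.2)
    have h2 : (C (1 / (T - t)) * X + C (-t / (T - t)) : ℝ[X]).natDegree ≤ 1 := by compute_degree
    nlinarith
  · set u : unitInterval := ⟨(x - t) / (T - t), div_nonneg (by linarith [hx.1]) hD.le,
      (div_le_one hD).2 (by linarith [hx.2])⟩ with hu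
    have hxu : x = t + (T - t) * (u : ℝ) := by
      simp only [hu]
      field_simp
      ring
    have hev : (∑ k : Fin (n + 1), C (f (node k)) *
        (bernsteinPolynomial ℝ n k).comp (C (1 / (T - t)) * X + C (-t / (T - t)))).eval x =
        ∑ k : Fin (n + 1), f (node k) * bernstein n k u := by
      rw [eval_finsetSum]
      refine Finset.sum_congr rfl fun k _ => ?_
      rw [eval_mul, eval_C, eval_comp]
      congr 1
      have : (C (1 / (T - t)) * X + C (-t / (T - t)) : ℝ[X]).eval x = u := by
        simp [hu]
        ring
      rw [this]
      rfl
    have hprob := bernstein.probability n u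
    have hnn : ∀ k : Fin (n + 1), 0 ≤ bernstein n k u := fun k => bernstein_nonneg
    rw [hev]
    constructor
    · calc |∑ k : Fin (n + 1), f (node k) * bernstein n k u|
          ≤ ∑ k : Fin (n + 1), |f (node k) * bernstein n k u| := Finset.abs_sum_le_sum_abs _ _
        _ ≤ ∑ k : Fin (n + 1), M * bernstein n k u := by
          refine Finset.sum_le_sum fun k _ => ?_
          rw [abs_mul, abs_of_nonneg (hnn k)]
          exact mul_le_mul_of_nonneg_right (hM _ (hnode k)) (hnn k)
        _ = M := by rw [← Finset.mul_sum, hprob, mul_one]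
    · have h1 : f x - ∑ k : Fin (n + 1), f (node k) * bernstein n k u =
          ∑ k : Fin (n + 1), (f x - f (node k)) * bernstein n k u := by
        simp only [sub_mul, Finset.sum_sub_distrib]
        rw [← Finset.mul_sum, hprob, mul_one]
      have h2 : (∑ k : Fin (n + 1), (f x - f (node k)) * bernstein n k u) ^ 2 ≤
          (∑ k : Fin (n + 1), bernstein n k u) *
          ∑ k : Fin (n + 1), (f x - f (node k)) ^ 2 * bernstein n k u :=
        Finset.sum_sq_le_sum_mul_sum_of_sq_le_mul _ (fun k _ => hnn k)
          (fun k _ => mul_nonneg (sq_nonneg _) (hnn k)) fun k _ => le_of_eq (by ring)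
      rw [hprob, one_mul] at h2
      rw [h1]
      refine h2.trans ?_
      calc ∑ k : Fin (n + 1), (f x - f (node k)) ^ 2 * bernstein n k u
          ≤ ∑ k : Fin (n + 1), (L * (T - t)) ^ 2 *
              (((u : ℝ) - bernstein.z k) ^ 2 * bernstein n k u) := by
            refine Finset.sum_le_sum fun k _ => ?_
            rw [← mul_assoc]
            refine mul_le_mul_of_nonneg_right ?_ (hnn k)
            have h3 := hf.dist_le_mul x hx (node k) (hnode k)
            rw [Real.dist_eq, Real.dist_eq] at h3
            rw [← sq_abs]
            refine (pow_le_pow_left₀ (abs_nonneg _) h3 2).trans (le_of_eq ?_)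
            rw [mul_pow, sq_abs]
            simp only [node, hxu]
            ring
        _ = (L * (T - t)) ^ 2 * (u * (1 - u) / n) := by
            rw [← Finset.mul_sum, bernstein.variance hn]
        _ ≤ (L * (T - t)) ^ 2 / n := by
            have h4 : (u : ℝ) * (1 - u) ≤ 1 := by nlinarith [u.2.1, u.2.2]
            rw [← mul_div_assoc]
            gcongr
            exact mul_le_of_le_one_right (by positivity) h4

end BernsteinApproximation

section Bessel

/-- Completing the square for the distance to a combination of an orthonormal family. -/
theorem integral_sq_sub_sum_orthonormal {α ι : Type*} [MeasurableSpace α] {μ : Measure α}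
    [Fintype ι] [DecidableEq ι] {K : α → ℝ} {E : ι → α → ℝ}
    (hK : Integrable (fun x => K x ^ 2) μ) (hKE : ∀ j, Integrable (fun x => K x * E j x) μ)
    (hEE : ∀ i j, Integrable (fun x => E i x * E j x) μ)
    (horth : ∀ i j, ∫ x, E i x * E j x ∂μ = if i = j then 1 else 0) (a : ι → ℝ) :
    ∫ x, (K x - ∑ j, a j * E j x) ^ 2 ∂μ =
      (∫ x, K x ^ 2 ∂μ) - ∑ j, (∫ x, K x * E j x ∂μ) ^ 2 +
        ∑ j, (a j - ∫ x, K x * E j x ∂μ) ^ 2 := by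
  have h1 : ∀ x, (K x - ∑ j, a j * E j x) ^ 2 =
      K x ^ 2 - ∑ j, (2 * a j) * (K x * E j x) +
        ∑ i, ∑ j, (a i * a j) * (E i x * E j x) := by
    intro x
    have e1 : ∑ j, (2 * a j) * (K x * E j x) = 2 * K x * ∑ j, a j * E j x := by
      rw [Finset.mul_sum]
      exact Finset.sum_congr rfl fun j _ => by ring
    have e2 : ∑ i, ∑ j, (a i * a j) * (E i x * E j x) =
        (∑ j, a j * E j x) * ∑ j, a j * E j x := by
      rw [Finset.sum_mul_sum]
      exact Finset.sum_congr rfl fun i _ => Finset.sum_congr rfl fun j _ => by ring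
    rw [e1, e2]
    ring
  have i1 : Integrable (fun x => ∑ j, (2 * a j) * (K x * E j x)) μ :=
    integrable_finsetSum _ fun j _ => (hKE j).const_mul _
  have i2 : ∀ i, Integrable (fun x => ∑ j, (a i * a j) * (E i x * E j x)) μ := fun i =>
    integrable_finsetSum _ fun j _ => (hEE i j).const_mul _
  have i3 : Integrable (fun x => K x ^ 2 - ∑ j, (2 * a j) * (K x * E j x)) μ := hK.sub i1
  simp only [h1]
  rw [integral_add i3 (integrable_finsetSum _ fun i _ => i2 i), integral_sub hK i1,
    integral_finsetSum _ fun j _ => (hKE j).const_mul _, integral_finsetSum _ fun i _ => i2 i]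
  have h2 : ∀ i, ∫ x, ∑ j, (a i * a j) * (E i x * E j x) ∂μ = a i ^ 2 := by
    intro i
    rw [integral_finsetSum _ fun j _ => (hEE i j).const_mul _]
    simp [integral_const_mul, horth, sq]
  simp only [h2, integral_const_mul]
  have h3 : ∑ j, (a j - ∫ x, K x * E j x ∂μ) ^ 2 =
      ∑ j, a j ^ 2 - ∑ j, 2 * a j * (∫ x, K x * E j x ∂μ) +
        ∑ j, (∫ x, K x * E j x ∂μ) ^ 2 := by
    rw [← Finset.sum_sub_distrib, ← Finset.sum_add_distrib]
    exact Finset.sum_congr rfl fun j _ => by ring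
  rw [h3]
  ring

theorem kernelK_mul_prod {k : ℕ} (ψ e : Fin k → ℝ → ℝ) (x : Fin k → ℝ) :
    kernelK ψ x * ∏ l, e l (x l) = kernelK (fun l s => ψ l s * e l s) x := by
  unfold kernelK
  split_ifs
  · rw [Finset.prod_mul_distrib]
  · simp

theorem kernelK_sq {k : ℕ} (ψ : Fin k → ℝ → ℝ) (x : Fin k → ℝ) :
    kernelK ψ x ^ 2 = kernelK (fun l s => ψ l s ^ 2) x := by
  unfold kernelK
  split_ifs
  · rw [Finset.prod_pow]
  · simp

theorem integral_sq_kernelK_sub_sum {t T : ℝ} (ht : t < T) {k : ℕ} {ψ : Fin k → ℝ → ℝ}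
    (hψ : ∀ l, ContinuousOn (ψ l) (Set.Icc t T)) (p : ℕ) (a : (Fin k → Fin (p + 1)) → ℝ) :
    ∫ x, (kernelK ψ x - ∑ j, a j * ∏ l, legendreSys t T (j l) (x l)) ^ 2 ∂boxMeasure t T k =
      (∫ x, kernelK ψ x ^ 2 ∂boxMeasure t T k) -
          ∑ j : Fin k → Fin (p + 1), (legCoef t T ψ fun l => (j l : ℕ)) ^ 2 +
        ∑ j : Fin k → Fin (p + 1), (a j - legCoef t T ψ fun l => (j l : ℕ)) ^ 2 := by
  classical
  have hc : ∀ j : Fin k → Fin (p + 1),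
      ∀ l, IntegrableOn (fun s => ψ l s * legendreSys t T (j l) s) (Set.Icc t T) := fun j l =>
    ((hψ l).mul (continuous_legendreSys t T _).continuousOn).integrableOn_Icc
  have hcoef : ∀ j : Fin k → Fin (p + 1),
      ∫ x, kernelK ψ x * ∏ l, legendreSys t T (j l) (x l) ∂boxMeasure t T k =
        legCoef t T ψ fun l => (j l : ℕ) := by
    intro j
    simp only [kernelK_mul_prod ψ fun l => legendreSys t T (j l)]
    exact integral_kernelK_eq_simplexIntegral ht.le (hc j)
  simp only [← hcoef]
  refine integral_sq_sub_sum_orthonormal ?_ (fun j => ?_) (fun i j => ?_) (fun i j => ?_) a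
  · simp only [kernelK_sq]
    exact integrable_kernelK fun l => ((hψ l).pow 2).integrableOn_Icc
  · simp only [kernelK_mul_prod ψ fun l => legendreSys t T (j l)]
    exact integrable_kernelK (hc j)
  · simp only [← Finset.prod_mul_distrib]
    exact Integrable.fintype_prod (f := fun l s => legendreSys t T (i l) s * legendreSys t T (j l) s)
      fun l => ((continuous_legendreSys t T _).mul
        (continuous_legendreSys t T _)).continuousOn.integrableOn_Icc
  · simp only [← Finset.prod_mul_distrib]
    rw [boxMeasure, integral_fintype_prod_eq_prod
      (fun l s => legendreSys t T (i l) s * legendreSys t T (j l) s)]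
    simp only [integral_legendreSys_mul ht, Fin.val_inj]
    rw [Fintype.prod_ite_zero]
    simp [funext_iff]

/-- The Fourier–Legendre truncation error is at most the error of any approximation by a
polynomial of degree at most `p` in each variable. -/
theorem integral_sq_kernelK_sub_sum_legCoef_le {t T : ℝ} (ht : t < T) {k : ℕ} {ψ : Fin k → ℝ → ℝ}
    (hψ : ∀ l, ContinuousOn (ψ l) (Set.Icc t T)) (p : ℕ) (G : MvPolynomial (Fin k) ℝ)
    (hG : ∀ i, G.degreeOf i ≤ p) :
    (∫ x, kernelK ψ x ^ 2 ∂boxMeasure t T k) -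
        ∑ j : Fin k → Fin (p + 1), (legCoef t T ψ fun l => (j l : ℕ)) ^ 2 ≤
      ∫ x, (kernelK ψ x - MvPolynomial.eval x G) ^ 2 ∂boxMeasure t T k := by
  have hmon : ∀ m : ℕ, ∃ b : Fin (p + 1) → ℝ, m ≤ p →
      ∀ x : ℝ, x ^ m = ∑ i, b i * legendreSys t T i x := by
    intro m
    by_cases hm : m ≤ p
    · obtain ⟨b, hb⟩ := exists_eval_eq_sum_legendreSys ht p (Polynomial.X ^ m)
        (by rwa [Polynomial.natDegree_X_pow])
      exact ⟨b, fun _ x => by simpa using hb x⟩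
    · exact ⟨0, fun h => absurd h hm⟩
  choose b hb using hmon
  have hspan : ∃ a : (Fin k → Fin (p + 1)) → ℝ, ∀ x : Fin k → ℝ,
      MvPolynomial.eval x G = ∑ j, a j * ∏ l, legendreSys t T (j l) (x l) := by
    refine ⟨fun j => ∑ d ∈ G.support, G.coeff d * ∏ l, b (d l) (j l), fun x => ?_⟩
    rw [MvPolynomial.eval_eq']
    simp only [Finset.sum_mul]
    rw [Finset.sum_comm]
    refine Finset.sum_congr rfl fun d hd => ?_
    have h1 : ∀ l, x l ^ d l = ∑ i, b (d l) i * legendreSys t T i (x l) := fun l =>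
      hb _ ((MvPolynomial.monomial_le_degreeOf l hd).trans (hG l)) _
    simp only [h1, Finset.prod_univ_sum, Fintype.piFinset_univ, Finset.mul_sum,
      Finset.prod_mul_distrib, mul_assoc]
  obtain ⟨a, ha⟩ := hspan
  simp only [ha]
  rw [integral_sq_kernelK_sub_sum ht hψ p a]
  exact le_add_of_nonneg_right (Finset.sum_nonneg fun j _ => sq_nonneg _)

end Bessel

section KernelApproximation

open Polynomial in
theorem MvPolynomial.degreeOf_aeval_le {σ : Type*} (P : MvPolynomial σ ℝ) (q : ℝ[X]) (i : σ) :
    (Polynomial.aeval P q).degreeOf i ≤ q.natDegree * P.degreeOf i := by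
  rw [Polynomial.aeval_eq_sum_range]
  refine (MvPolynomial.degreeOf_sum_le _ _ _).trans (Finset.sup_le fun n hn => ?_)
  rw [MvPolynomial.smul_eq_C_mul]
  refine (MvPolynomial.degreeOf_C_mul_le _ _ _).trans ((MvPolynomial.degreeOf_pow_le _ _ _).trans ?_)
  exact Nat.mul_le_mul_right _ (Nat.lt_succ_iff.1 (Finset.mem_range.1 hn))

theorem abs_prod_sub_prod_le {ι : Type*} (s : Finset ι) {f g : ι → ℝ} {M : ℝ} (hM : 1 ≤ M)
    (hf : ∀ i ∈ s, |f i| ≤ M) (hg : ∀ i ∈ s, |g i| ≤ M) :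
    |∏ i ∈ s, f i - ∏ i ∈ s, g i| ≤ M ^ s.card * ∑ i ∈ s, |f i - g i| := by
  classical
  induction s using Finset.induction_on with
  | empty => simp
  | insert a s ha ih =>
    have h1 := ih (fun i hi => hf i (Finset.mem_insert_of_mem hi))
      fun i hi => hg i (Finset.mem_insert_of_mem hi)
    have h2 : |∏ i ∈ s, g i| ≤ M ^ s.card := by
      rw [Finset.abs_prod, ← Finset.prod_const]
      exact Finset.prod_le_prod (fun i _ => abs_nonneg _)
        fun i hi => hg i (Finset.mem_insert_of_mem hi)
    have h3 : M ^ s.card ≤ M ^ (s.card + 1) := pow_le_pow_right₀ hM (Nat.le_succ _)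
    rw [Finset.prod_insert ha, Finset.prod_insert ha, Finset.sum_insert ha,
      Finset.card_insert_of_notMem ha]
    calc |f a * ∏ i ∈ s, f i - g a * ∏ i ∈ s, g i|
        = |f a * (∏ i ∈ s, f i - ∏ i ∈ s, g i) + (f a - g a) * ∏ i ∈ s, g i| := by ring_nf
      _ ≤ |f a| * |∏ i ∈ s, f i - ∏ i ∈ s, g i| + |f a - g a| * |∏ i ∈ s, g i| := by
        simpa only [abs_mul] using abs_add_le (f a * (∏ i ∈ s, f i - ∏ i ∈ s, g i))
          ((f a - g a) * ∏ i ∈ s, g i)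
      _ ≤ M * (M ^ s.card * ∑ i ∈ s, |f i - g i|) + |f a - g a| * M ^ (s.card + 1) := by
        gcongr
        · exact hf a (Finset.mem_insert_self a s)
        · exact h2.trans h3
      _ = M ^ (s.card + 1) * (|f a - g a| + ∑ i ∈ s, |f i - g i|) := by ring

theorem sq_prod_sub_prod_le {ι : Type*} [Fintype ι] {f g : ι → ℝ} {M : ℝ} (hM : 1 ≤ M)
    (hf : ∀ i, |f i| ≤ M) (hg : ∀ i, |g i| ≤ M) :
    (∏ i, f i - ∏ i, g i) ^ 2 ≤
      (M ^ Fintype.card ι) ^ 2 * (Fintype.card ι * ∑ i, (f i - g i) ^ 2) := by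
  have h1 := abs_prod_sub_prod_le Finset.univ hM (fun i _ => hf i) fun i _ => hg i
  have h2 := sq_sum_le_card_mul_sum_sq (s := Finset.univ) (f := fun i => |f i - g i|)
  simp only [sq_abs, Finset.card_univ] at h1 h2
  calc (∏ i, f i - ∏ i, g i) ^ 2 = |∏ i, f i - ∏ i, g i| ^ 2 := (sq_abs _).symm
    _ ≤ (M ^ Fintype.card ι * ∑ i, |f i - g i|) ^ 2 := by gcongr
    _ ≤ _ := by rw [mul_pow]; gcongr

theorem kernelK_eq_prod_mul_prod {k : ℕ} (ψ : Fin (k + 1) → ℝ → ℝ) (x : Fin (k + 1) → ℝ) :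
    kernelK ψ x =
      (∏ l, ψ l (x l)) * ∏ i : Fin k, if 0 < x i.succ - x i.castSucc then 1 else 0 := by
  unfold kernelK
  rw [Fintype.prod_ite_zero]
  simp only [Fin.strictMono_iff_lt_succ, sub_pos, Finset.prod_const_one, mul_ite, mul_one,
    mul_zero]

theorem ae_boxMeasure_mem_Icc (t T : ℝ) (k : ℕ) :
    ∀ᵐ x ∂boxMeasure t T k, ∀ l, x l ∈ Set.Icc t T := by
  rw [ae_all_iff]
  intro l
  exact (Measure.tendsto_eval_ae_ae (i := l)
    (μ := fun _ : Fin k => (volume : Measure ℝ).restrict (Set.Icc t T))).eventually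
      (ae_restrict_mem measurableSet_Icc)

theorem abs_sub_le_of_mem_Icc {t T a b : ℝ} (ha : a ∈ Set.Icc t T) (hb : b ∈ Set.Icc t T) :
    |a - b| ≤ T - t :=
  abs_le.2 ⟨by linarith [ha.1, hb.2], by linarith [ha.2, hb.1]⟩

theorem integrable_comp_sub_boxMeasure {t T : ℝ} {k : ℕ} (a b : Fin k) {g : ℝ → ℝ}
    (hg : Measurable g) {M : ℝ} (hM : ∀ u, |u| ≤ T - t → |g u| ≤ M) :
    Integrable (fun x => g (x a - x b)) (boxMeasure t T k) := by
  refine Integrable.of_bound (C := M)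
    (hg.comp ((measurable_pi_apply a).sub (measurable_pi_apply b))).aestronglyMeasurable ?_
  filter_upwards [ae_boxMeasure_mem_Icc t T k] with x hx
  exact hM _ (abs_sub_le_of_mem_Icc (hx a) (hx b))

theorem integral_comp_sub_boxMeasure_le {t T : ℝ} (ht : t ≤ T) {k : ℕ} {a b : Fin (k + 1)}
    (hab : b ≠ a) {g : ℝ → ℝ} (hg : Measurable g) (hg0 : ∀ u, 0 ≤ g u) {M : ℝ}
    (hM : ∀ u, |u| ≤ T - t → |g u| ≤ M) :
    ∫ x, g (x a - x b) ∂boxMeasure t T (k + 1) ≤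
      (boxMeasure t T k).real Set.univ * ∫ u in (-(T - t))..(T - t), g u := by
  obtain ⟨b, rfl⟩ := Fin.exists_succAbove_eq hab
  have hint := integrable_comp_insertNth a (integrable_comp_sub_boxMeasure a (a.succAbove b) hg hM)
  rw [integral_boxMeasure_eq_integral_prod a]
  simp only [Fin.insertNth_apply_same, Fin.insertNth_apply_succAbove] at hint ⊢
  rw [integral_prod_symm _ hint, ← smul_eq_mul, ← integral_const]
  have hgi : IntervalIntegrable g volume (-(T - t)) (T - t) := by
    rw [intervalIntegrable_iff_integrableOn_Icc_of_le (by linarith)]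
    refine Integrable.of_bound (C := M) hg.aestronglyMeasurable ?_
    filter_upwards [ae_restrict_mem measurableSet_Icc] with u hu
    exact hM u (abs_le.2 hu)
  refine integral_mono_ae hint.integral_prod_right (integrable_const _) ?_
  filter_upwards [ae_boxMeasure_mem_Icc t T k] with y hy
  have hyb := hy b
  rw [integral_Icc_eq_integral_Ioc, ← intervalIntegral.integral_of_le ht,
    intervalIntegral.integral_comp_sub_right g]
  exact intervalIntegral.integral_mono_interval (by linarith [hyb.2]) (by linarith)
    (by linarith [hyb.1]) (Filter.Eventually.of_forall hg0) hgi

/-- For Lipschitz weights the kernel is approximated at rate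
`1 / (r + 1)` in squared `L²` norm by polynomials whose degree is linear in `r`. -/
theorem exists_integral_sq_kernelK_sub_eval_le {t T : ℝ} (ht : t < T) {k : ℕ}
    {ψ : Fin (k + 1) → ℝ → ℝ} {L : Fin (k + 1) → NNReal}
    (hL : ∀ l, LipschitzOnWith (L l) (ψ l) (Set.Icc t T)) :
    ∃ C : ℝ, 0 ≤ C ∧ ∀ r : ℕ, ∃ G : MvPolynomial (Fin (k + 1)) ℝ,
      (∀ i, G.degreeOf i ≤ (k + 1) * (r + 1) + k * (8 * r + 1)) ∧
      ∫ x, (kernelK ψ x - MvPolynomial.eval x G) ^ 2 ∂boxMeasure t T (k + 1) ≤ C / (r + 1) := by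
  classical
  set D := T - t with hD
  have hD0 : 0 < D := sub_pos.2 ht
  obtain ⟨M, hM1, hM⟩ : ∃ M : ℝ, 1 ≤ M ∧ ∀ l, ∀ x ∈ Set.Icc t T, |ψ l x| ≤ M := by
    choose B hB using fun l => isCompact_Icc.exists_bound_of_continuousOn (hL l).continuousOn
    refine ⟨1 + ∑ l, |B l|, le_add_of_nonneg_right (Finset.sum_nonneg fun _ _ => abs_nonneg _),
      fun l x hx => ?_⟩
    have h1 := hB l x hx
    have h2 := Finset.single_le_sum (fun i _ => abs_nonneg (B i)) (Finset.mem_univ l)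
    rw [Real.norm_eq_abs] at h1
    linarith [le_abs_self (B l)]
  set N := Fintype.card (Fin (k + 1) ⊕ Fin k) with hN
  set V := (boxMeasure t T (k + 1)).real Set.univ with hV
  set W := (boxMeasure t T k).real Set.univ with hW
  refine ⟨(M ^ N) ^ 2 * (N * (V * ∑ l, (L l * D) ^ 2 + k * (W * (D * 64)))), by positivity,
    fun r => ?_⟩
  choose q hqdeg hq using fun l =>
    exists_polynomial_near_of_lipschitzOnWith ht (hL l) (hM l) (Nat.succ_ne_zero r)
  obtain ⟨h, hdeg, hb, hint⟩ := exists_step_polynomial r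
  let P : Fin k → MvPolynomial (Fin (k + 1)) ℝ := fun i =>
    MvPolynomial.C (1 / D) * (MvPolynomial.X i.succ - MvPolynomial.X i.castSucc)
  let G : MvPolynomial (Fin (k + 1)) ℝ :=
    (∏ l, Polynomial.aeval (MvPolynomial.X l) (q l)) * ∏ i, Polynomial.aeval (P i) h
  have hG : ∀ x, MvPolynomial.eval x G =
      (∏ l, (q l).eval (x l)) * ∏ i : Fin k, h.eval ((x i.succ - x i.castSucc) / D) := by
    intro x
    have e : ∀ (Q : MvPolynomial (Fin (k + 1)) ℝ) (p : Polynomial ℝ),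
        MvPolynomial.eval x (Polynomial.aeval Q p) = p.eval (MvPolynomial.eval x Q) := by
      intro Q p
      rw [Polynomial.aeval_def, Polynomial.hom_eval₂]
      rw [Polynomial.eval, show (MvPolynomial.eval x).comp
        (algebraMap ℝ (MvPolynomial (Fin (k + 1)) ℝ)) = RingHom.id ℝ from by ext; simp]
    simp only [G, P, map_mul, map_prod, e, MvPolynomial.eval_X, MvPolynomial.eval_C, map_sub]
    simp only [one_div, inv_mul_eq_div]
  refine ⟨G, fun i => ?_, ?_⟩
  · have hX : ∀ j, (MvPolynomial.X j : MvPolynomial (Fin (k + 1)) ℝ).degreeOf i ≤ 1 := by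
      intro j
      rw [MvPolynomial.degreeOf_X]
      split_ifs <;> simp
    have h1 : ∀ l, (Polynomial.aeval (MvPolynomial.X l : MvPolynomial (Fin (k + 1)) ℝ)
        (q l)).degreeOf i ≤ r + 1 := fun l =>
      (MvPolynomial.degreeOf_aeval_le _ _ _).trans
        ((Nat.mul_le_mul (hqdeg l) (hX l)).trans (mul_one _).le)
    have h2 : ∀ j, (Polynomial.aeval (P j) h).degreeOf i ≤ 8 * r + 1 := fun j =>
      (MvPolynomial.degreeOf_aeval_le _ _ _).trans ((Nat.mul_le_mul hdeg
        ((MvPolynomial.degreeOf_C_mul_le _ _ _).trans ((MvPolynomial.degreeOf_sub_le _ _ _).trans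
          (max_le (hX _) (hX _))))).trans (mul_one _).le)
    refine (MvPolynomial.degreeOf_mul_le _ _ _).trans (Nat.add_le_add
      ((MvPolynomial.degreeOf_prod_le _ _ _).trans ((Finset.sum_le_sum fun l _ => h1 l).trans ?_))
      ((MvPolynomial.degreeOf_prod_le _ _ _).trans ((Finset.sum_le_sum fun j _ => h2 j).trans ?_)))
      <;> simp
  let g : ℝ → ℝ := fun u => ((if 0 < u then 1 else 0) - h.eval (u / D)) ^ 2
  have hg : Measurable g := by
    have : Measurable fun u : ℝ => if 0 < u then (1 : ℝ) else 0 :=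
      Measurable.ite measurableSet_Ioi measurable_const measurable_const
    have h2 : Measurable fun u : ℝ => h.eval (u / D) :=
      (h.continuous.comp (continuous_id.div_const D)).measurable
    exact (this.sub h2).pow_const 2
  have hdiv : ∀ u, |u| ≤ D → |u / D| ≤ 1 := fun u hu => by
    rwa [abs_div, abs_of_pos hD0, div_le_one hD0]
  have hle : ∀ v, |v| ≤ 1 → |h.eval v - if 0 < v then 1 else 0| ≤ 1 := by
    intro v hv
    obtain ⟨h1, h2⟩ := hb v hv
    split_ifs <;> rw [abs_le] <;> constructor <;> linarith
  have hgle : ∀ u, |u| ≤ D → g u ≤ |h.eval (u / D) - if 0 < u / D then 1 else 0| := by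
    intro u hu
    have h1 := hle _ (hdiv u hu)
    simp only [g, div_pos_iff_of_pos_right hD0] at h1 ⊢
    rw [sub_sq_comm, ← sq_abs, sq]
    exact mul_le_of_le_one_left (abs_nonneg _) h1
  have hgb : ∀ u, |u| ≤ D → |g u| ≤ 1 := fun u hu => by
    rw [abs_of_nonneg (sq_nonneg _)]
    exact (hgle u hu).trans (hle _ (hdiv u hu))
  have hgint : ∫ u in (-D)..D, g u ≤ D * 64 / (r + 1) := by
    have hm : Measurable fun v : ℝ => |h.eval v - if 0 < v then 1 else 0| :=
      (h.continuous.measurable.sub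
        (Measurable.ite measurableSet_Ioi measurable_const measurable_const)).abs
    have hii : ∀ f : ℝ → ℝ, Measurable f → (∀ u, |u| ≤ D → |f u| ≤ 1) →
        IntervalIntegrable f volume (-D) D := by
      intro f hf hf1
      rw [intervalIntegrable_iff_integrableOn_Icc_of_le (by linarith)]
      refine Integrable.of_bound (C := 1) hf.aestronglyMeasurable ?_
      filter_upwards [ae_restrict_mem measurableSet_Icc] with u hu
      exact hf1 u (abs_le.2 hu)
    calc ∫ u in (-D)..D, g u
        ≤ ∫ u in (-D)..D, |h.eval (u / D) - if 0 < u / D then 1 else 0| := by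
          refine intervalIntegral.integral_mono_on (by linarith) (hii g hg hgb)
            (hii _ (hm.comp (measurable_id.div_const D)) fun u hu => ?_)
            fun u hu => hgle u (abs_le.2 hu)
          rw [abs_abs]
          exact hle _ (hdiv u hu)
      _ = D * ∫ v in (-1 : ℝ)..1, |h.eval v - if 0 < v then 1 else 0| := by
          rw [intervalIntegral.integral_comp_div
            (fun v => |h.eval v - if 0 < v then 1 else 0|) hD0.ne', smul_eq_mul, neg_div,
            div_self hD0.ne']
      _ ≤ D * (64 / (2 * r + 1)) := by gcongr
      _ ≤ D * (64 / (r + 1)) := by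
          gcongr
          linarith [(Nat.cast_nonneg r : (0 : ℝ) ≤ r)]
      _ = D * 64 / (r + 1) := by ring
  have hgi : ∀ i : Fin k,
      Integrable (fun x => g (x i.succ - x i.castSucc)) (boxMeasure t T (k + 1)) := fun i =>
    integrable_comp_sub_boxMeasure _ _ hg hgb
  have hsum : Integrable (fun x => ∑ i : Fin k, g (x i.succ - x i.castSucc))
      (boxMeasure t T (k + 1)) := integrable_finsetSum _ fun i _ => hgi i
  have hpt : ∀ᵐ x ∂boxMeasure t T (k + 1), (kernelK ψ x - MvPolynomial.eval x G) ^ 2 ≤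
      (M ^ N) ^ 2 * (N * (∑ l, (L l * D) ^ 2 / (r + 1) +
        ∑ i : Fin k, g (x i.succ - x i.castSucc))) := by
    filter_upwards [ae_boxMeasure_mem_Icc t T (k + 1)] with x hx
    have hu : ∀ i : Fin k, |x i.succ - x i.castSucc| ≤ D := fun i =>
      abs_sub_le_of_mem_Icc (hx _) (hx _)
    have key := sq_prod_sub_prod_le (ι := Fin (k + 1) ⊕ Fin k) (M := M)
      (f := Sum.elim (fun l => ψ l (x l))
        fun i => if 0 < x i.succ - x i.castSucc then 1 else 0)
      (g := Sum.elim (fun l => (q l).eval (x l))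
        fun i => h.eval ((x i.succ - x i.castSucc) / D)) hM1 ?_ ?_
    · simp only [Fintype.prod_sum_type, Fintype.sum_sum_type, Sum.elim_inl, Sum.elim_inr] at key
      rw [kernelK_eq_prod_mul_prod, hG]
      refine key.trans ?_
      gcongr with l _
      exact_mod_cast (hq l (x l) (hx l)).2
    · rintro (l | i)
      · exact hM l _ (hx l)
      · simp only [Sum.elim_inr]
        split_ifs <;> simp <;> linarith
    · rintro (l | i)
      · exact (hq l (x l) (hx l)).1
      · obtain ⟨h1, h2⟩ := hb _ (hdiv _ (hu i))
        simp only [Sum.elim_inr, abs_of_nonneg h1]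
        exact h2.trans hM1
  calc ∫ x, (kernelK ψ x - MvPolynomial.eval x G) ^ 2 ∂boxMeasure t T (k + 1)
      ≤ ∫ x, (M ^ N) ^ 2 * (N * (∑ l, (L l * D) ^ 2 / (r + 1) +
          ∑ i : Fin k, g (x i.succ - x i.castSucc))) ∂boxMeasure t T (k + 1) :=
        integral_mono_of_nonneg (Filter.Eventually.of_forall fun _ => sq_nonneg _)
          ((((integrable_const _).add hsum).const_mul _).const_mul _) hpt
    _ = (M ^ N) ^ 2 * (N * (V * (∑ l, (L l * D) ^ 2 / (r + 1)) +
          ∑ i : Fin k, ∫ x, g (x i.succ - x i.castSucc) ∂boxMeasure t T (k + 1))) := by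
        rw [integral_const_mul, integral_const_mul, integral_add (integrable_const _) hsum,
          integral_finsetSum _ fun i _ => hgi i, integral_const, smul_eq_mul]
    _ ≤ (M ^ N) ^ 2 * (N * (V * (∑ l, (L l * D) ^ 2 / (r + 1)) +
          ∑ i : Fin k, W * (D * 64 / (r + 1)))) := by
        gcongr with i _
        refine (integral_comp_sub_boxMeasure_le ht.le (Fin.castSucc_lt_succ).ne hg
          (fun _ => sq_nonneg _) hgb).trans ?_
        gcongr
    _ = _ := by
        rw [← Finset.sum_div, Finset.sum_const, Finset.card_univ, Fintype.card_fin, nsmul_eq_mul]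
        ring

end KernelApproximation

theorem stmt_17 (t T : ℝ) (ht : t < T) (ψ : Fin 4 → ℝ → ℝ)
    (hψ : ∀ l, ContDiffOn ℝ 1 (ψ l) (Set.Icc t T)) :
    ∀ ε : ℝ, 0 < ε → ε < 1 →
      ∃ C : ℝ, ∀ p : ℕ, 1 ≤ p →
        (0 ≤ (∫ x, (kernelK ψ x) ^ 2 ∂(boxMeasure t T 4)) -
            ∑ j : Fin 4 → Fin (p + 1), (legCoef t T ψ fun l => (j l : ℕ)) ^ 2) ∧
        (∫ x, (kernelK ψ x) ^ 2 ∂(boxMeasure t T 4)) -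
            ∑ j : Fin 4 → Fin (p + 1), (legCoef t T ψ fun l => (j l : ℕ)) ^ 2 ≤
          C / (p : ℝ) ^ (1 - ε) := by
  intro ε hε hε1
  have hc : ∀ l, ContinuousOn (ψ l) (Set.Icc t T) := fun l => (hψ l).continuousOn
  choose L hL using fun l => (hψ l).exists_lipschitzOnWith one_ne_zero (convex_Icc t T)
    isCompact_Icc
  obtain ⟨C, hC, happ⟩ := exists_integral_sq_kernelK_sub_eval_le ht hL
  set I := ∫ x, kernelK ψ x ^ 2 ∂boxMeasure t T 4 with hI
  have hI0 : 0 ≤ I := integral_nonneg fun x => sq_nonneg _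
  refine ⟨7 * I + 35 * C, fun p hp => ⟨?_, ?_⟩⟩
  · have h := integral_sq_kernelK_sub_sum ht hc p fun j => legCoef t T ψ fun l => (j l : ℕ)
    simp only [sub_self, ne_eq, OfNat.ofNat_ne_zero, not_false_eq_true, zero_pow,
      Finset.sum_const_zero, add_zero] at h
    rw [← h]
    exact integral_nonneg fun x => sq_nonneg _
  have hp0 : (0 : ℝ) < p := by exact_mod_cast hp
  have hpow : (7 * I + 35 * C) / p ≤ (7 * I + 35 * C) / (p : ℝ) ^ (1 - ε) := by
    have h1 : (1 : ℝ) ≤ p := by exact_mod_cast hp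
    have h2 : (p : ℝ) ^ (1 - ε) ≤ p := by
      simpa using Real.rpow_le_rpow_of_exponent_le h1 (by linarith : 1 - ε ≤ 1)
    gcongr
  refine le_trans ?_ hpow
  rcases lt_or_ge p 7 with h7 | h7
  · have h1 : (p : ℝ) ≤ 7 := by exact_mod_cast h7.le
    calc I - ∑ j : Fin 4 → Fin (p + 1), (legCoef t T ψ fun l => (j l : ℕ)) ^ 2
        ≤ I := sub_le_self _ (Finset.sum_nonneg fun _ _ => sq_nonneg _)
      _ ≤ (7 * I + 35 * C) / p := by
        rw [le_div_iff₀ hp0]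
        nlinarith
  · obtain ⟨G, hdeg, hG⟩ := happ ((p - 7) / 28)
    have h1 := integral_sq_kernelK_sub_sum_legCoef_le ht hc p G fun i => (hdeg i).trans (by omega)
    refine (h1.trans hG).trans ?_
    have h2 : (p : ℝ) ≤ 35 * (((p - 7) / 28 : ℕ) + 1) := by
      exact_mod_cast (by omega : p ≤ 35 * ((p - 7) / 28 + 1))
    rw [div_le_div_iff₀ (by positivity) hp0]
    nlinarith [mul_le_mul_of_nonneg_left h2 hC,
      mul_nonneg hI0 (by positivity : (0 : ℝ) ≤ ((p - 7) / 28 : ℕ) + 1)]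
end
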